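/- arXiv:2507.21752 — 2 statements merged into one kernel-verified Lean document; each statement's English description precedes it below -/
import Mathlib

section
/- Let O ⊆ {¬,⊓,⊔,∀,∃} contain at least one of ∃/∀ and at least one of ⊓/⊔, and let A be a fitting algorithm for L(O). Then A is not a sample-efficient PAC learning algorithm if any of the following holds: (1) O ≠ {∃,⊔} and A always returns a most specific fitting whenever a fitting exists; (2) O ≠ {∀,⊓} and A always returns a most general fitting whenever a fitting exists; (3) A always returns a fitting of minimal quantifier depth whenever some fitting exists. -/
open scoped ENNReal

namespace ALCPaper

/-- ALC concepts; concept names and role names are natural numbers. -/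
inductive ALC : Type
  | bot
  | top
  | atom (A : ℕ)
  | neg (c : ALC)
  | inter (c d : ALC)
  | union (c d : ALC)
  | all (r : ℕ) (c : ALC)
  | ex (r : ℕ) (c : ALC)
  deriving DecidableEq

/-- An interpretation: a domain of natural numbers, extensions of concept names,
and extensions of role names. -/
structure Interp where
  dom : Set ℕ
  cI : ℕ → Set ℕ
  rI : ℕ → Set (ℕ × ℕ)

/-- Well-formedness of an interpretation: the domain is nonempty, concept name
extensions are subsets of the domain and role name extensions are binary relations
on the domain. -/
def Interp.WF (I : Interp) : Prop :=
  I.dom.Nonempty ∧ (∀ A, I.cI A ⊆ I.dom) ∧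
    ∀ r, ∀ p ∈ I.rI r, p.1 ∈ I.dom ∧ p.2 ∈ I.dom

/-- The extension `C^I` of a concept `C` in an interpretation `I`. -/
def ALC.sem : ALC → Interp → Set ℕ
  | .bot, _ => ∅
  | .top, I => I.dom
  | .atom A, I => I.cI A
  | .neg c, I => I.dom \ c.sem I
  | .inter c d, I => c.sem I ∩ d.sem I
  | .union c d, I => c.sem I ∪ d.sem I
  | .all r c, I => {d | d ∈ I.dom ∧ ∀ e, (d, e) ∈ I.rI r → e ∈ c.sem I}
  | .ex r c, I => {d | ∃ e, (d, e) ∈ I.rI r ∧ e ∈ c.sem I}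

/-- The size of a concept: the number of nodes of its syntax tree. -/
def ALC.size : ALC → ℕ
  | .bot => 1
  | .top => 1
  | .atom _ => 1
  | .neg c => c.size + 1
  | .inter c d => c.size + d.size + 1
  | .union c d => c.size + d.size + 1
  | .all _ c => c.size + 1
  | .ex _ c => c.size + 1

/-- The quantifier depth of a concept: the nesting depth of ∃/∀. -/
def ALC.qdepth : ALC → ℕ
  | .bot => 0
  | .top => 0
  | .atom _ => 0
  | .neg c => c.qdepth
  | .inter c d => max c.qdepth d.qdepth
  | .union c d => max c.qdepth d.qdepth
  | .all _ c => c.qdepth + 1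
  | .ex _ c => c.qdepth + 1

/-- The concept names occurring in a concept. -/
def ALC.conceptNames : ALC → Finset ℕ
  | .bot => ∅
  | .top => ∅
  | .atom A => {A}
  | .neg c => c.conceptNames
  | .inter c d => c.conceptNames ∪ d.conceptNames
  | .union c d => c.conceptNames ∪ d.conceptNames
  | .all _ c => c.conceptNames
  | .ex _ c => c.conceptNames

/-- The role names occurring in a concept. -/
def ALC.roleNames : ALC → Finset ℕ
  | .bot => ∅
  | .top => ∅
  | .atom _ => ∅
  | .neg c => c.roleNames
  | .inter c d => c.roleNames ∪ d.roleNames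
  | .union c d => c.roleNames ∪ d.roleNames
  | .all r c => insert r c.roleNames
  | .ex r c => insert r c.roleNames

/-- The five constructors ¬, ⊓, ⊔, ∀, ∃. -/
inductive Op : Type
  | neg | inter | union | all | ex
  deriving DecidableEq

/-- Membership in the fragment L(O): the concept is built from ⊤, ⊥ and concept
names using only constructors from O. -/
def ALC.InLang (O : Set Op) : ALC → Prop
  | .bot => True
  | .top => True
  | .atom _ => True
  | .neg c => Op.neg ∈ O ∧ c.InLang O
  | .inter c d => Op.inter ∈ O ∧ c.InLang O ∧ d.InLang O
  | .union c d => Op.union ∈ O ∧ c.InLang O ∧ d.InLang O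
  | .all _ c => Op.all ∈ O ∧ c.InLang O
  | .ex _ c => Op.ex ∈ O ∧ c.InLang O

/-- The dual of a constructor. -/
def Op.dual : Op → Op
  | .neg => .neg
  | .inter => .union
  | .union => .inter
  | .all => .ex
  | .ex => .all

/-- The dual concept C̄. -/
def ALC.dual : ALC → ALC
  | .bot => .top
  | .top => .bot
  | .atom A => .atom A
  | .neg c => .neg c.dual
  | .inter c d => .union c.dual d.dual
  | .union c d => .inter c.dual d.dual
  | .all r c => .ex r c.dual
  | .ex r c => .all r c.dual

open Classical in
/-- The interpretation Ī_Σ obtained by complementing the extensions of the concept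
names in Σ (here `S` is the set of concept names of the signature Σ). -/
noncomputable def Interp.dualWrt (I : Interp) (S : Set ℕ) : Interp where
  dom := I.dom
  cI := fun A => if A ∈ S then I.dom \ I.cI A else I.cI A
  rI := I.rI

/-- A pointed interpretation. -/
abbrev Ex : Type := Interp × ℕ

/-- A finite interpretation: finite domain and only finitely many concept and role
names with nonempty extension. -/
def Interp.FiniteI (I : Interp) : Prop :=
  I.dom.Finite ∧ {A | (I.cI A).Nonempty}.Finite ∧ {r | (I.rI r).Nonempty}.Finite

/-- An example: a finite (well-formed) interpretation with a distinguished domain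
element. -/
def IsExample (e : Ex) : Prop := e.1.WF ∧ e.1.FiniteI ∧ e.2 ∈ e.1.dom

/-- The dual example (Ī_Σ, a). -/
noncomputable def dualEx (S : Set ℕ) (e : Ex) : Ex := (e.1.dualWrt S, e.2)

/-- `C` fits the positive examples `P` and the negative examples `N`. -/
def Fits (C : ALC) (P N : Set Ex) : Prop :=
  (∀ e ∈ P, e.2 ∈ C.sem e.1) ∧ ∀ e ∈ N, e.2 ∉ C.sem e.1

/-- Subsumption C ⊑ D: `C^I ⊆ D^I` for every interpretation `I`. -/
def Subsume (C D : ALC) : Prop := ∀ I : Interp, I.WF → C.sem I ⊆ D.sem I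

/-- Equivalence of concepts. -/
def CEquiv (C D : ALC) : Prop := Subsume C D ∧ Subsume D C

/-- The concept names occurring in (the facts of) a set of examples. -/
def exCNames (E : Set Ex) : Set ℕ := {A | ∃ e ∈ E, (e.1.cI A).Nonempty}

/-- The role names occurring in (the facts of) a set of examples. -/
def exRNames (E : Set Ex) : Set ℕ := {r | ∃ e ∈ E, (e.1.rI r).Nonempty}

/-- Number of facts of an interpretation, viewed as a set of facts `A(d)`, `r(d,e)`. -/
noncomputable def Interp.numFacts (I : Interp) : ℕ :=
  {p : ℕ × ℕ | p.2 ∈ I.cI p.1}.ncard + {t : ℕ × ℕ × ℕ | (t.2.1, t.2.2) ∈ I.rI t.1}.ncard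

/-- The size of an example: number of facts plus one. -/
noncomputable def exSize (e : Ex) : ℕ := e.1.numFacts + 1

/-- Probability of a set of examples under a distribution. -/
noncomputable def probOf (D : PMF Ex) (S : Set Ex) : ℝ≥0∞ :=
  ∑' e : Ex, S.indicator (fun x => D x) e

/-- The error of a hypothesis `CH` with respect to a target `CT`:
the probability of the examples labeled differently by `CT` and `CH`. -/
noncomputable def errP (D : PMF Ex) (CT CH : ALC) : ℝ≥0∞ :=
  probOf D {e | Xor' (e.2 ∈ CT.sem e.1) (e.2 ∈ CH.sem e.1)}

/-- Probability that a tuple of `M` examples drawn independently from `D` lies in `T`. -/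
noncomputable def iidProb (D : PMF Ex) (M : ℕ) (T : Set (Fin M → Ex)) : ℝ≥0∞ :=
  ∑' f : Fin M → Ex, T.indicator (fun g => ∏ i, D (g i)) f

/-- `D` is a probability distribution over examples over the signature (Sc, Sr),
each of size at most `s`. -/
def DistOverSig (D : PMF Ex) (Sc Sr : Set ℕ) (s : ℕ) : Prop :=
  ∀ e : Ex, D e ≠ 0 → IsExample e ∧ exSize e ≤ s ∧
    (∀ A, (e.1.cI A).Nonempty → A ∈ Sc) ∧ ∀ r, (e.1.rI r).Nonempty → r ∈ Sr

/-- The positive examples of a drawn sample, labeled according to the target `CT`. -/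
def posOf {M : ℕ} (f : Fin M → Ex) (CT : ALC) : Set Ex :=
  {e | (∃ i, f i = e) ∧ e.2 ∈ CT.sem e.1}

/-- The negative examples of a drawn sample, labeled according to the target `CT`. -/
def negOf {M : ℕ} (f : Fin M → Ex) (CT : ALC) : Set Ex :=
  {e | (∃ i, f i = e) ∧ e.2 ∉ CT.sem e.1}

/-- A fitting algorithm for L(O): on finite sets of examples it returns an L(O)
concept fitting them whenever some L(O) concept fits. -/
def IsFittingAlg (O : Set Op) (Alg : Set Ex → Set Ex → ALC) : Prop :=
  ∀ P N : Set Ex, P.Finite → N.Finite → (∀ e ∈ P ∪ N, IsExample e) →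
    (∃ C : ALC, C.InLang O ∧ Fits C P N) →
    (Alg P N).InLang O ∧ Fits (Alg P N) P N

/-- `m` is bounded by a polynomial in its arguments. -/
def PolyBound (m : ℝ → ℝ → ℕ → ℕ → ℕ → ℕ) : Prop :=
  ∃ c d : ℕ, ∀ (x y : ℝ) (a b e : ℕ),
    m x y a b e ≤ c * (⌈|x|⌉₊ + ⌈|y|⌉₊ + a + b + e + 1) ^ d

/-- `Alg` is a sample-efficient PAC learning algorithm for L(O): there is a
polynomial sample bound m such that for all ε, δ ∈ (0,1), all signatures, all size
bounds s, n, all distributions over examples over the signature of size at most s,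
and all targets in L(O) over the signature of size at most n, with probability at
least 1 − δ over m(1/δ, 1/ε, |Σ|, s, n) i.i.d. labeled examples, the output is an
L(O) concept with error at most ε. -/
def SampleEfficientPAC (O : Set Op) (Alg : Set Ex → Set Ex → ALC) : Prop :=
  ∃ m : ℝ → ℝ → ℕ → ℕ → ℕ → ℕ, PolyBound m ∧
    ∀ ε δ : ℝ, 0 < ε → ε < 1 → 0 < δ → δ < 1 →
      ∀ Sc Sr : Set ℕ, Sc.Finite → Sr.Finite →
        ∀ s n : ℕ, ∀ D : PMF Ex, DistOverSig D Sc Sr s →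
          ∀ CT : ALC, CT.InLang O → (CT.conceptNames : Set ℕ) ⊆ Sc →
            (CT.roleNames : Set ℕ) ⊆ Sr → CT.size ≤ n →
            1 - ENNReal.ofReal δ ≤
              iidProb D (m (1 / δ) (1 / ε) (Sc.ncard + Sr.ncard) s n)
                {f | (Alg (posOf f CT) (negOf f CT)).InLang O ∧
                  errP D CT (Alg (posOf f CT) (negOf f CT)) ≤ ENNReal.ofReal ε}

/-- `Alg` always returns a most specific fitting whenever a fitting exists. -/
def ReturnsMostSpecific (O : Set Op) (Alg : Set Ex → Set Ex → ALC) : Prop :=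
  ∀ P N : Set Ex, P.Finite → N.Finite → (∀ e ∈ P ∪ N, IsExample e) →
    (∃ C : ALC, C.InLang O ∧ Fits C P N) →
    Fits (Alg P N) P N ∧
      ¬∃ D : ALC, D.InLang O ∧ Fits D P N ∧ Subsume D (Alg P N) ∧ ¬CEquiv D (Alg P N)

/-- `Alg` always returns a most general fitting whenever a fitting exists. -/
def ReturnsMostGeneral (O : Set Op) (Alg : Set Ex → Set Ex → ALC) : Prop :=
  ∀ P N : Set Ex, P.Finite → N.Finite → (∀ e ∈ P ∪ N, IsExample e) →
    (∃ C : ALC, C.InLang O ∧ Fits C P N) →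
    Fits (Alg P N) P N ∧
      ¬∃ D : ALC, D.InLang O ∧ Fits D P N ∧ Subsume (Alg P N) D ∧ ¬CEquiv (Alg P N) D

/-- `Alg` always returns a fitting of minimal quantifier depth whenever a fitting
exists. -/
def ReturnsMinQDepth (O : Set Op) (Alg : Set Ex → Set Ex → ALC) : Prop :=
  ∀ P N : Set Ex, P.Finite → N.Finite → (∀ e ∈ P ∪ N, IsExample e) →
    (∃ C : ALC, C.InLang O ∧ Fits C P N) →
    Fits (Alg P N) P N ∧
      ∀ D : ALC, D.InLang O → Fits D P N → (Alg P N).qdepth ≤ D.qdepth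

set_option linter.deprecated false

lemma toNat_inj' {a b : Bool} (h : a.toNat = b.toNat) : a = b := by
  cases a <;> cases b <;> simp_all

lemma sem_sub_dom (C : ALC) (I : Interp) (h : I.WF) : C.sem I ⊆ I.dom := by
  induction C with
  | bot => simp [ALC.sem]
  | top => simp [ALC.sem]
  | atom A => exact h.2.1 A
  | neg c ih => exact Set.diff_subset
  | inter c d ih1 ih2 => exact fun a ha => ih1 ha.1
  | union c d ih1 ih2 => exact Set.union_subset ih1 ih2
  | all r c ih => exact fun a ha => ha.1
  | ex r c ih => rintro a ⟨e, he, -⟩; exact (h.2.2 r _ he).1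

/-- The example lives in a box of side `N`. -/
def Boxed (e : Ex) (N : ℕ) : Prop :=
  e.1.WF ∧ e.2 ∈ e.1.dom ∧ (∀ a ∈ e.1.dom, a < N) ∧ (∀ A, (e.1.cI A).Nonempty → A < N) ∧
    ∀ r, (e.1.rI r).Nonempty → r < N

lemma Boxed.isExample {e : Ex} {N : ℕ} (h : Boxed e N) : IsExample e := by
  obtain ⟨h1, h2, h3, h4, h5⟩ := h
  exact ⟨h1, ⟨(Set.finite_Iio N).subset h3, (Set.finite_Iio N).subset h4,
    (Set.finite_Iio N).subset h5⟩, h2⟩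

lemma Boxed.size {e : Ex} {N : ℕ} (h : Boxed e N) : exSize e ≤ N * N + N * (N * N) + 1 := by
  obtain ⟨h1, h2, h3, h4, h5⟩ := h
  unfold exSize Interp.numFacts
  have a1 : {p : ℕ × ℕ | p.2 ∈ e.1.cI p.1}.ncard ≤ N * N := by
    have : {p : ℕ × ℕ | p.2 ∈ e.1.cI p.1} ⊆ (Finset.range N ×ˢ Finset.range N : Finset (ℕ × ℕ)) := by
      rintro ⟨p, q⟩ hp
      simp only [Finset.coe_product, Set.mem_prod, Finset.mem_coe, Finset.mem_range]
      exact ⟨h4 p ⟨q, hp⟩, h3 q (h1.2.1 p hp)⟩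
    refine (Set.ncard_le_ncard this (Finset.finite_toSet _)).trans ?_
    rw [Set.ncard_coe_finset]; simp
  have a2 : {t : ℕ × ℕ × ℕ | (t.2.1, t.2.2) ∈ e.1.rI t.1}.ncard ≤ N * (N * N) := by
    have : {t : ℕ × ℕ × ℕ | (t.2.1, t.2.2) ∈ e.1.rI t.1} ⊆
        (Finset.range N ×ˢ (Finset.range N ×ˢ Finset.range N) : Finset (ℕ × ℕ × ℕ)) := by
      rintro ⟨p, q, r⟩ hp
      simp only [Finset.coe_product, Set.mem_prod, Finset.mem_coe, Finset.mem_range]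
      exact ⟨h5 p ⟨_, hp⟩, h3 q (h1.2.2 p _ hp).1, h3 r (h1.2.2 p _ hp).2⟩
    refine (Set.ncard_le_ncard this (Finset.finite_toSet _)).trans ?_
    rw [Set.ncard_coe_finset]; simp
  omega

/-- chain of existentials -/
def exP (w : ℕ → ℕ) : ℕ → ℕ → ALC
  | 0, _ => .top
  | k + 1, i => .ex (w i) (exP w k (i + 1))

/-- chain of universals -/
def alP (w : ℕ → ℕ) : ℕ → ℕ → ALC
  | 0, _ => .bot
  | k + 1, i => .all (w i) (alP w k (i + 1))

lemma alP_sem (w : ℕ → ℕ) (I : Interp) (hI : I.WF) (k : ℕ) : ∀ i d, d ∈ I.dom →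
    (d ∈ (alP w k i).sem I ↔ d ∉ (exP w k i).sem I) := by
  induction k with
  | zero => intro i d hd; simp [alP, exP, ALC.sem, hd]
  | succ k ih =>
    intro i d hd
    simp only [alP, exP, ALC.sem, Set.mem_setOf_eq, hd, true_and, not_exists, not_and]
    exact forall_congr' fun e => imp_congr_right fun he => ih _ _ (hI.2.2 _ _ he).2

lemma exP_qd (w : ℕ → ℕ) (k : ℕ) : ∀ i, (exP w k i).qdepth = k := by
  induction k with
  | zero => intro i; rfl
  | succ k ih => intro i; simp [exP, ALC.qdepth, ih]

lemma alP_qd (w : ℕ → ℕ) (k : ℕ) : ∀ i, (alP w k i).qdepth = k := by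
  induction k with
  | zero => intro i; rfl
  | succ k ih => intro i; simp [alP, ALC.qdepth, ih]

lemma exP_size (w : ℕ → ℕ) (k : ℕ) : ∀ i, (exP w k i).size = k + 1 := by
  induction k with
  | zero => intro i; rfl
  | succ k ih => intro i; simp [exP, ALC.size, ih]

lemma alP_size (w : ℕ → ℕ) (k : ℕ) : ∀ i, (alP w k i).size = k + 1 := by
  induction k with
  | zero => intro i; rfl
  | succ k ih => intro i; simp [alP, ALC.size, ih]

lemma exP_lang {O : Set Op} (h : Op.ex ∈ O) (w : ℕ → ℕ) (k : ℕ) : ∀ i, (exP w k i).InLang O := by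
  induction k with
  | zero => intro i; trivial
  | succ k ih => intro i; exact ⟨h, ih _⟩

lemma alP_lang {O : Set Op} (h : Op.all ∈ O) (w : ℕ → ℕ) (k : ℕ) : ∀ i, (alP w k i).InLang O := by
  induction k with
  | zero => intro i; trivial
  | succ k ih => intro i; exact ⟨h, ih _⟩

lemma exP_cn (w : ℕ → ℕ) (k : ℕ) : ∀ i, (exP w k i).conceptNames = ∅ := by
  induction k with
  | zero => intro i; rfl
  | succ k ih => intro i; simp [exP, ALC.conceptNames, ih]

lemma alP_cn (w : ℕ → ℕ) (k : ℕ) : ∀ i, (alP w k i).conceptNames = ∅ := by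
  induction k with
  | zero => intro i; rfl
  | succ k ih => intro i; simp [alP, ALC.conceptNames, ih]

lemma exP_rn (c k : ℕ) : ∀ i, ∀ r ∈ (exP (fun _ => c) k i).roleNames, r = c := by
  induction k with
  | zero => intro i; simp [exP, ALC.roleNames]
  | succ k ih =>
    intro i r hr
    simp only [exP, ALC.roleNames, Finset.mem_insert] at hr
    exact hr.elim id (ih _ r)

lemma alP_rn (c k : ℕ) : ∀ i, ∀ r ∈ (alP (fun _ => c) k i).roleNames, r = c := by
  induction k with
  | zero => intro i; simp [alP, ALC.roleNames]
  | succ k ih =>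
    intro i r hr
    simp only [alP, ALC.roleNames, Finset.mem_insert] at hr
    exact hr.elim id (ih _ r)

/-- bounded bisimulation -/
lemma agree (I J : Interp) (hd : I.dom = J.dom) (hcI : I.cI = J.cI) (Z : ℕ → ℕ → Prop)
    (h1 : ∀ k d, Z (k + 1) d → ∀ r e, (d, e) ∈ I.rI r ↔ (d, e) ∈ J.rI r)
    (h2 : ∀ k d, Z (k + 1) d → ∀ r e, (d, e) ∈ I.rI r → Z k e) (C : ALC) :
    ∀ k, C.qdepth ≤ k → ∀ d, Z k d → (d ∈ C.sem I ↔ d ∈ C.sem J) := by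
  induction C with
  | bot => intro k _ d _; simp [ALC.sem]
  | top => intro k _ d _; simp [ALC.sem, hd]
  | atom A => intro k _ d _; simp [ALC.sem, hcI]
  | neg c ih => intro k hk d hz; simp [ALC.sem, hd, ih k hk d hz]
  | inter c e ih1 ih2 =>
    intro k hk d hz
    simp only [ALC.qdepth, sup_le_iff] at hk
    simp [ALC.sem, ih1 k hk.1 d hz, ih2 k hk.2 d hz]
  | union c e ih1 ih2 =>
    intro k hk d hz
    simp only [ALC.qdepth, sup_le_iff] at hk
    simp [ALC.sem, ih1 k hk.1 d hz, ih2 k hk.2 d hz]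
  | all r c ih =>
    intro k hk d hz
    obtain ⟨k, rfl⟩ : ∃ k', k = k' + 1 := ⟨k - 1, by simp [ALC.qdepth] at hk; omega⟩
    simp only [ALC.qdepth, add_le_add_iff_right] at hk
    simp only [ALC.sem, Set.mem_setOf_eq, hd]
    refine and_congr_right fun _ => forall_congr' fun e => ?_
    rw [← h1 k d hz r e]
    exact imp_congr_right fun he => ih k hk e (h2 k d hz r e he)
  | ex r c ih =>
    intro k hk d hz
    obtain ⟨k, rfl⟩ : ∃ k', k = k' + 1 := ⟨k - 1, by simp [ALC.qdepth] at hk; omega⟩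
    simp only [ALC.qdepth, add_le_add_iff_right] at hk
    simp only [ALC.sem, Set.mem_setOf_eq]
    refine exists_congr fun e => ?_
    rw [← h1 k d hz r e]
    exact and_congr_right fun he => ih k hk e (h2 k d hz r e he)

/-- word interpretations -/
def wI (g : Bool) (n : ℕ) (x : ℕ → Bool) (l : ℕ) : Interp where
  dom := {a | a < 2 * n + 4}
  cI := fun _ => ∅
  rI := fun r => {p | (r = 2 ∧ p.1 < l ∧ p.2 = p.1 + 1) ∨
    (r < 2 ∧ ((g = true ∧ p.1 < n ∧ r = (x p.1).toNat ∧ p.2 = p.1 + 1) ∨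
      (g = false ∧ ((p.1 + 1 < n ∧ r = (x p.1).toNat ∧ p.2 = p.1 + 1) ∨
        (p.1 < n ∧ r ≠ (x p.1).toNat ∧ p.2 = n + 3 + p.1) ∨
        (n + 2 ≤ p.1 ∧ p.1 < 2 * n + 2 ∧ p.2 = p.1 + 1)))))}

lemma wI_boxed (g : Bool) (n : ℕ) (x : ℕ → Bool) (l : ℕ) (hl : l ≤ n + 1) :
    Boxed (wI g n x l, 0) (4 * n + 8) := by
  refine ⟨⟨⟨0, ?_⟩, ?_, ?_⟩, ?_, ?_, ?_, ?_⟩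
  · simp [wI]
  · simp [wI]
  · rintro r ⟨a, b⟩ h
    simp only [wI, Set.mem_setOf_eq] at h ⊢
    omega
  · simp [wI]
  · intro a ha; simp only [wI, Set.mem_setOf_eq] at ha; omega
  · simp [wI]
  · rintro r ⟨⟨a, b⟩, h⟩
    simp only [wI, Set.mem_setOf_eq] at h
    omega

lemma wI_agree (g : Bool) (n : ℕ) (x : ℕ → Bool) (C : ALC) (hC : C.qdepth ≤ n) :
    0 ∈ C.sem (wI g n x n) ↔ 0 ∈ C.sem (wI g n x (n + 1)) := by
  refine agree (wI g n x n) (wI g n x (n + 1)) rfl rfl (fun k d => d + k ≤ n ∨ n + 2 ≤ d)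
    ?_ ?_ C n hC 0 (by simp)
  · intro k d h r e; simp only [wI, Set.mem_setOf_eq]
    refine or_congr ?_ Iff.rfl; omega
  · intro k d h r e; simp only [wI, Set.mem_setOf_eq]; omega

lemma wI_chain (g : Bool) (n : ℕ) (x : ℕ → Bool) (l : ℕ) (hl : l ≤ n + 1) (k : ℕ) :
    ∀ i d, d ≤ l → (d ∈ (exP (fun _ => 2) k i).sem (wI g n x l) ↔ d + k ≤ l) := by
  induction k with
  | zero => intro i d hd; simp only [exP, ALC.sem, wI, Set.mem_setOf_eq]; omega
  | succ k ih =>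
    intro i d hd
    simp only [exP, ALC.sem, Set.mem_setOf_eq]
    constructor
    · rintro ⟨e, he, h⟩
      have : d < l ∧ e = d + 1 := by
        simp only [wI, Set.mem_setOf_eq] at he; omega
      obtain ⟨h1, rfl⟩ := this
      rw [ih _ _ (by omega)] at h; omega
    · intro h
      refine ⟨d + 1, ?_, ?_⟩
      · exact Or.inl ⟨rfl, (by omega : d < l), rfl⟩
      · rw [ih _ _ (by omega)]; omega

lemma wI_true (n : ℕ) (x u : ℕ → Bool) (l : ℕ) (k : ℕ) :
    ∀ i, i + k = n → (i ∈ (exP (fun j => (u j).toNat) k i).sem (wI true n x l) ↔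
      ∀ j, i ≤ j → j < n → u j = x j) := by
  induction k with
  | zero =>
    intro i hi
    simp only [exP, ALC.sem, wI, Set.mem_setOf_eq]
    exact ⟨fun _ j _ _ => by omega, fun _ => by omega⟩
  | succ k ih =>
    intro i hi
    simp only [exP, ALC.sem, Set.mem_setOf_eq]
    have hu : (u i).toNat < 2 := Bool.toNat_lt _
    constructor
    · rintro ⟨e, he, h⟩
      have : (u i).toNat = (x i).toNat ∧ e = i + 1 := by
        simp only [wI, Set.mem_setOf_eq] at he
        simp at he; omega
      obtain ⟨h1, rfl⟩ := this
      rw [ih _ (by omega)] at h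
      intro j hj hjn
      rcases Nat.eq_or_lt_of_le hj with rfl | hj
      · exact toNat_inj' h1
      · exact h j hj hjn
    · intro h
      refine ⟨i + 1, ?_, ?_⟩
      · simp only [wI, Set.mem_setOf_eq]
        have := congrArg Bool.toNat (h i le_rfl (by omega))
        simp; omega
      · rw [ih _ (by omega)]; exact fun j hj => h j (by omega)

lemma wI_diff (n : ℕ) (x u : ℕ → Bool) (l : ℕ) (k : ℕ) :
    ∀ i, i + k = n → n + 2 + i ∈ (exP (fun j => (u j).toNat) k i).sem (wI false n x l) := by
  induction k with
  | zero => intro i hi; simp only [exP, ALC.sem, wI, Set.mem_setOf_eq]; omega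
  | succ k ih =>
    intro i hi
    have hu : (u i).toNat < 2 := Bool.toNat_lt _
    refine ⟨n + 2 + (i + 1), ?_, ih _ (by omega)⟩
    simp only [wI, Set.mem_setOf_eq]
    simp; omega

lemma wI_false (n : ℕ) (x u : ℕ → Bool) (l : ℕ) (k : ℕ) :
    ∀ i, i + k = n → (i ∈ (exP (fun j => (u j).toNat) k i).sem (wI false n x l) ↔
      k = 0 ∨ ∃ j, i ≤ j ∧ j < n ∧ u j ≠ x j) := by
  induction k with
  | zero =>
    intro i hi
    simp only [exP, ALC.sem, wI, Set.mem_setOf_eq]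
    simp; omega
  | succ k ih =>
    intro i hi
    simp only [exP, ALC.sem, Set.mem_setOf_eq]
    have hu : (u i).toNat < 2 := Bool.toNat_lt _
    constructor
    · rintro ⟨e, he, h⟩
      right
      by_cases hx : u i = x i
      · have hx' := congrArg Bool.toNat hx
        have : i + 1 < n ∧ e = i + 1 := by
          simp only [wI, Set.mem_setOf_eq] at he
          simp at he; omega
        obtain ⟨h1, rfl⟩ := this
        rw [ih _ (by omega)] at h
        rcases h with h | ⟨j, h1, h2, h3⟩
        · omega
        · exact ⟨j, by omega, h2, h3⟩
      · exact ⟨i, le_rfl, by omega, hx⟩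
    · rintro (h | ⟨j, h1, h2, h3⟩)
      · omega
      by_cases hx : u i = x i
      · have hx' := congrArg Bool.toNat hx
        have hij : i ≠ j := by rintro rfl; exact h3 hx
        refine ⟨i + 1, ?_, ?_⟩
        · simp only [wI, Set.mem_setOf_eq]
          simp; omega
        · rw [ih _ (by omega)]; exact Or.inr ⟨j, by omega, h2, h3⟩
      · have hx' : (u i).toNat ≠ (x i).toNat := fun h => hx (toNat_inj' h)
        refine ⟨n + 2 + (i + 1), ?_, wI_diff _ _ _ _ _ _ (by omega)⟩
        simp only [wI, Set.mem_setOf_eq]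
        simp; omega

/-- extend a word -/
def extW {n : ℕ} (x : Fin n → Bool) (j : ℕ) : Bool := if h : j < n then x ⟨j, h⟩ else false

lemma extW_iff {n : ℕ} (x u : Fin n → Bool) :
    (∀ j, 0 ≤ j → j < n → extW u j = extW x j) ↔ x = u := by
  constructor
  · intro h; funext j
    have := h j (by omega) j.2
    simpa [extW] using this.symm
  · rintro rfl; simp

/-- The word families. -/
lemma family (O : Set Op) (hq : Op.ex ∈ O ∨ Op.all ∈ O) (want : Bool) (n : ℕ) (hn : 0 < n) :
    ∃ (e : (Fin n → Bool) × Bool → Ex) (D : (Fin n → Bool) → ALC) (T : ALC),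
      (∀ i, Boxed (e i) (4 * n + 8)) ∧ T.InLang O ∧ T.size ≤ 4 * n + 8 ∧
      (∀ A ∈ T.conceptNames, A < 4 * n + 8) ∧ (∀ A ∈ T.roleNames, A < 4 * n + 8) ∧
      (∀ x, (D x).InLang O ∧ (D x).qdepth ≤ n) ∧
      (∀ i y, (e i).2 ∈ (D y).sem (e i).1 ↔ (if want then i.1 = y else i.1 ≠ y)) ∧
      (∀ x, ¬((e (x, true)).2 ∈ T.sem (e (x, true)).1 ↔
        (e (x, false)).2 ∈ T.sem (e (x, false)).1)) ∧
      ∀ H : ALC, H.qdepth ≤ n → ∀ x, ((e (x, true)).2 ∈ H.sem (e (x, true)).1 ↔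
        (e (x, false)).2 ∈ H.sem (e (x, false)).1) := by
  have key : ∀ (g : Bool) (x u : Fin n → Bool) l, 0 ∈ (exP (fun j => (extW u j).toNat) n 0).sem
      (wI g n (extW x) l) ↔ (if g then x = u else x ≠ u) := by
    intro g x u l
    cases g
    · rw [wI_false n _ _ l n 0 (by omega)]
      simp only [hn.ne', false_or, Bool.false_eq_true, if_false]
      rw [Ne, ← extW_iff]; push Not; rfl
    · rw [wI_true n _ _ l n 0 (by omega), extW_iff]; simp
  have hl : ∀ b : Bool, (if b then n else n + 1) ≤ n + 1 := by intro b; split <;> omega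
  rcases hq with hq | hq
  · refine ⟨fun i => (wI want n (extW i.1) (if i.2 then n else n + 1), 0),
      fun y => exP (fun j => (extW y j).toNat) n 0, exP (fun _ => 2) (n + 1) 0,
      fun i => wI_boxed _ _ _ _ (hl _), exP_lang hq _ _ _, ?_, ?_, ?_, ?_, ?_, ?_, ?_⟩
    · rw [exP_size]; omega
    · rw [exP_cn]; simp
    · intro A hA; have := exP_rn _ _ _ A hA; omega
    · exact fun x => ⟨exP_lang hq _ _ _, (exP_qd _ _ _).le⟩
    · intro i y; exact key _ _ _ _
    · intro x
      simp only [if_true, Bool.false_eq_true, if_false]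
      rw [wI_chain _ _ _ _ (by omega) _ _ _ (by omega), wI_chain _ _ _ _ (by omega) _ _ _ (by omega)]
      omega
    · intro H hH x
      exact wI_agree _ _ _ _ hH
  · have hb : ∀ g (x : Fin n → Bool) l, l ≤ n + 1 → (wI g n (extW x) l).WF ∧ 0 ∈ (wI g n (extW x) l).dom :=
      fun g x l h => ⟨(wI_boxed g n (extW x) l h).1, (wI_boxed g n (extW x) l h).2.1⟩
    refine ⟨fun i => (wI (!want) n (extW i.1) (if i.2 then n else n + 1), 0),
      fun y => alP (fun j => (extW y j).toNat) n 0, alP (fun _ => 2) (n + 1) 0,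
      fun i => wI_boxed _ _ _ _ (hl _), alP_lang hq _ _ _, ?_, ?_, ?_, ?_, ?_, ?_, ?_⟩
    · rw [alP_size]; omega
    · rw [alP_cn]; simp
    · intro A hA; have := alP_rn _ _ _ A hA; omega
    · exact fun x => ⟨alP_lang hq _ _ _, (alP_qd _ _ _).le⟩
    · intro i y
      have h := hb (!want) i.1 _ (hl i.2)
      rw [alP_sem _ _ h.1 _ _ _ h.2, key]
      cases want <;> simp
    · intro x
      simp only [if_true, Bool.false_eq_true, if_false]
      have h1 := hb (!want) x n (by omega)
      have h2 := hb (!want) x (n + 1) (by omega)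
      rw [alP_sem _ _ h1.1 _ _ _ h1.2, alP_sem _ _ h2.1 _ _ _ h2.2,
        wI_chain _ _ _ _ (by omega) _ _ _ (by omega), wI_chain _ _ _ _ (by omega) _ _ _ (by omega)]
      omega
    · intro H hH x
      exact wI_agree _ _ _ _ hH

section prob

variable {ι : Type} [Fintype ι] [Nonempty ι]

lemma map_unif (e : ι → Ex) (a : Ex) [DecidableEq Ex] :
    ((PMF.uniformOfFintype ι).map e) a = ∑ i : ι, if a = e i then (Fintype.card ι : ℝ≥0∞)⁻¹ else 0 := by
  rw [PMF.map_apply, tsum_fintype]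
  refine Finset.sum_congr rfl fun i _ => ?_
  simp only [PMF.uniformOfFintype_apply]

open Classical in
lemma probOf_eq (e : ι → Ex) (S : Set Ex) :
    probOf ((PMF.uniformOfFintype ι).map e) S =
      (Finset.univ.filter fun i => e i ∈ S).card * (Fintype.card ι : ℝ≥0∞)⁻¹ := by
  unfold probOf
  have h1 : ∀ a : Ex, S.indicator (fun x => ((PMF.uniformOfFintype ι).map e) x) a =
      ∑ i : ι, if a = e i then (if e i ∈ S then (Fintype.card ι : ℝ≥0∞)⁻¹ else 0) else 0 := by
    intro a
    by_cases ha : a ∈ S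
    · rw [Set.indicator_of_mem ha, map_unif]
      refine Finset.sum_congr rfl fun i _ => ?_
      by_cases h : a = e i
      · subst h; simp [ha]
      · simp [h]
    · rw [Set.indicator_of_notMem ha]
      symm
      refine Finset.sum_eq_zero fun i _ => ?_
      by_cases h : a = e i
      · subst h; simp [ha]
      · simp [h]
  simp_rw [h1]
  rw [Summable.tsum_finsetSum fun _ _ => ENNReal.summable]
  simp_rw [tsum_ite_eq]
  rw [← Finset.sum_filter, Finset.sum_const, nsmul_eq_mul]

open Classical in
lemma iidProb_eq (e : ι → Ex) (M : ℕ) (T : Set (Fin M → Ex)) :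
    iidProb ((PMF.uniformOfFintype ι).map e) M T =
      (Finset.univ.filter fun g : Fin M → ι => (fun i => e (g i)) ∈ T).card *
        ((Fintype.card ι : ℝ≥0∞)⁻¹) ^ M := by
  unfold iidProb
  have h0 : ∀ f : Fin M → Ex, ∏ i, ((PMF.uniformOfFintype ι).map e) (f i) =
      ∑ g : Fin M → ι, if f = (fun i => e (g i)) then ((Fintype.card ι : ℝ≥0∞)⁻¹) ^ M else 0 := by
    intro f
    simp_rw [map_unif]
    rw [Finset.prod_univ_sum]
    rw [Fintype.piFinset_univ]
    refine Finset.sum_congr rfl fun g _ => ?_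
    by_cases h : f = fun i => e (g i)
    · subst h; simp
    · rw [if_neg h]
      obtain ⟨i, hi⟩ : ∃ i, f i ≠ e (g i) := by
        by_contra hh; push Not at hh; exact h (funext hh)
      exact Finset.prod_eq_zero (Finset.mem_univ i) (by simp [hi])
  have h1 : ∀ f : Fin M → Ex, T.indicator (fun g => ∏ i, ((PMF.uniformOfFintype ι).map e) (g i)) f =
      ∑ g : Fin M → ι, if f = (fun i => e (g i)) then
        (if (fun i => e (g i)) ∈ T then ((Fintype.card ι : ℝ≥0∞)⁻¹) ^ M else 0) else 0 := by
    intro f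
    by_cases ha : f ∈ T
    · rw [Set.indicator_of_mem ha, h0]
      refine Finset.sum_congr rfl fun g _ => ?_
      by_cases h : f = fun i => e (g i)
      · subst h; simp [ha]
      · simp [h]
    · rw [Set.indicator_of_notMem ha]
      symm
      refine Finset.sum_eq_zero fun g _ => ?_
      by_cases h : f = fun i => e (g i)
      · subst h; simp [ha]
      · simp [h]
  simp_rw [h1]
  rw [Summable.tsum_finsetSum fun _ _ => ENNReal.summable]
  simp_rw [tsum_ite_eq]
  rw [← Finset.sum_filter, Finset.sum_const, nsmul_eq_mul]

end prob

open Classical in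
lemma birthday_pair {X Y : Type} [Fintype X] [Fintype Y] {M : ℕ} (i j : Fin M) (hij : i ≠ j) :
    (Finset.univ.filter fun g : Fin M → X × Y => (g i).1 = (g j).1).card * Fintype.card X ≤
      Fintype.card (X × Y) ^ M := by
  have : Fintype.card (X × Y) ^ M = (Finset.univ : Finset (Fin M → X × Y)).card := by simp
  rw [this, ← Finset.card_univ (α := X), ← Finset.card_product]
  refine Finset.card_le_card_of_injOn
    (fun q => Function.update q.1 j (q.2, (q.1 j).2)) (fun _ _ => Finset.mem_coe.2 (Finset.mem_univ _)) ?_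
  rintro ⟨g, y⟩ hg ⟨g', y'⟩ hg' h
  simp only [Finset.coe_product, Set.mem_prod, Finset.mem_coe, Finset.mem_filter,
    Finset.mem_univ, true_and, and_true] at hg hg'
  have hk : ∀ k, k ≠ j → g k = g' k := by
    intro k hk
    have := congrFun h k
    simpa [Function.update_of_ne hk] using this
  have hj := congrFun h j
  simp only [Function.update_self, Prod.mk.injEq] at hj
  have : g j = g' j := by
    apply Prod.ext
    · rw [← hg, ← hg', hk i hij]
    · exact hj.2
  refine Prod.ext (funext fun k => ?_) hj.1
  by_cases h : k = j
  · subst h; exact this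
  · exact hk k h

open Classical in
lemma birthday {X Y : Type} [Fintype X] [Fintype Y] (M : ℕ) :
    (Finset.univ.filter fun g : Fin M → X × Y => ¬ Function.Injective fun i => (g i).1).card *
      Fintype.card X ≤ M ^ 2 * Fintype.card (X × Y) ^ M := by
  have hsub : (Finset.univ.filter fun g : Fin M → X × Y => ¬ Function.Injective fun i => (g i).1) ⊆
      (Finset.univ.filter fun p : Fin M × Fin M => p.1 ≠ p.2).biUnion
        fun p => Finset.univ.filter fun g : Fin M → X × Y => (g p.1).1 = (g p.2).1 := by
    intro g hg
    have hg := (Finset.mem_filter.1 hg).2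
    unfold Function.Injective at hg
    push Not at hg
    obtain ⟨a, b, h1, h2⟩ := hg
    simp only [Finset.mem_biUnion, Finset.mem_filter, Finset.mem_univ, true_and]
    exact ⟨(a, b), h2, h1⟩
  calc _ ≤ (∑ p ∈ (Finset.univ.filter fun p : Fin M × Fin M => p.1 ≠ p.2),
        (Finset.univ.filter fun g : Fin M → X × Y => (g p.1).1 = (g p.2).1).card) * Fintype.card X :=
        Nat.mul_le_mul_right _ ((Finset.card_le_card hsub).trans Finset.card_biUnion_le)
    _ = ∑ p ∈ (Finset.univ.filter fun p : Fin M × Fin M => p.1 ≠ p.2),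
        (Finset.univ.filter fun g : Fin M → X × Y => (g p.1).1 = (g p.2).1).card * Fintype.card X := by
        rw [Finset.sum_mul]
    _ ≤ ∑ p ∈ (Finset.univ.filter fun p : Fin M × Fin M => p.1 ≠ p.2), Fintype.card (X × Y) ^ M := by
        refine Finset.sum_le_sum fun p hp => birthday_pair _ _ ?_
        simpa using hp
    _ ≤ M ^ 2 * Fintype.card (X × Y) ^ M := by
        rw [Finset.sum_const, smul_eq_mul]
        refine Nat.mul_le_mul_right _ ?_
        refine (Finset.card_filter_le _ _).trans ?_
        simp [sq]

lemma poly_exp (c d : ℕ) : ∃ n : ℕ, 0 < n ∧ c * (n + 1) ^ d ≤ 2 ^ n := by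
  have h := tendsto_pow_const_div_const_pow_of_one_lt d (r := 2) (by norm_num)
  have h2 : Filter.Tendsto (fun n : ℕ => ((n + 1 : ℕ) : ℝ) ^ d / 2 ^ (n + 1)) Filter.atTop (nhds 0) :=
    h.comp (Filter.tendsto_add_atTop_nat 1)
  have h3 := h2.eventually (gt_mem_nhds (show (0 : ℝ) < 1 / (2 * (c + 1)) by positivity))
  obtain ⟨n, hn, h4⟩ := ((Filter.eventually_ge_atTop 1).and h3).exists
  refine ⟨n, hn, ?_⟩
  have hc : (0 : ℝ) < 2 * (c + 1) := by positivity
  rw [div_lt_div_iff₀ (by positivity) hc] at h4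
  have h5 : ((c * (n + 1) ^ d : ℕ) : ℝ) ≤ ((2 ^ n : ℕ) : ℝ) := by
    push_cast at h4 ⊢
    rw [pow_succ] at h4
    have : (0 : ℝ) ≤ ((n : ℝ) + 1) ^ d := by positivity
    nlinarith
  exact_mod_cast h5

/-- The set of wrong indices. -/
noncomputable def wrongSet {ι : Type} [Fintype ι] (e : ι → Ex) (T H : ALC) : Finset ι := by
  classical
  exact Finset.univ.filter fun i => Xor' ((e i).2 ∈ T.sem (e i).1) ((e i).2 ∈ H.sem (e i).1)

lemma mem_wrongSet {ι : Type} [Fintype ι] (e : ι → Ex) (T H : ALC) (i : ι) :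
    i ∈ wrongSet e T H ↔ ¬ ((e i).2 ∈ T.sem (e i).1 ↔ (e i).2 ∈ H.sem (e i).1) := by
  simp only [wrongSet, Finset.mem_filter, Finset.mem_univ, true_and]
  unfold Xor' Xor; tauto

lemma bound_aux (n c d N M x : ℕ) (hN : N = 4 * n + 8) (hx : x = N)
    (hMb : M ≤ c * (⌈|(1 / (1 / 2) : ℝ)|⌉₊ + ⌈|(1 / (1 / 8) : ℝ)|⌉₊ + (x + x) +
      (N * N + N * (N * N) + 1) + N + 1) ^ d) :
    M ≤ c * (3000 ^ d * (n + 1) ^ (3 * d)) := by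
  refine hMb.trans (Nat.mul_le_mul_left _ ?_)
  have e1 : ⌈|(1 / (1 / 2) : ℝ)|⌉₊ = 2 := by norm_num
  have e2 : ⌈|(1 / (1 / 8) : ℝ)|⌉₊ = 8 := by norm_num
  rw [e1, e2, hx, pow_mul, ← mul_pow]
  refine Nat.pow_le_pow_left ?_ d
  have : N ≤ 8 * (n + 1) := by omega
  calc _ = 12 + 3 * N + N * N + N * N * N := by ring
    _ ≤ 12 + 3 * (8 * (n + 1)) + (8 * (n + 1)) * (8 * (n + 1)) +
        (8 * (n + 1)) * (8 * (n + 1)) * (8 * (n + 1)) := by gcongr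
    _ ≤ 3000 * (n + 1) ^ 3 := by nlinarith [Nat.zero_le n, Nat.zero_le (n ^ 2), Nat.zero_le (n ^ 3)]

lemma bound_aux2 (n c d M B : ℕ) (hM1 : M ≤ c * (B * (n + 1) ^ (3 * d)))
    (hbig : (4 * c ^ 2 * B ^ 2) * (n + 1) ^ (2 * (3 * d)) ≤ 2 ^ n) :
    4 * M ^ 2 ≤ 2 ^ n := by
  refine le_trans ?_ hbig
  calc 4 * M ^ 2 ≤ 4 * (c * (B * (n + 1) ^ (3 * d))) ^ 2 := by gcongr
    _ = 4 * c ^ 2 * B ^ 2 * (n + 1) ^ (2 * (3 * d)) := by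
      rw [mul_comm 2 (3 * d), pow_mul _ (3 * d) 2]; ring

lemma final_aux (n M k : ℕ) (hle : k * 2 ^ n ≤ M ^ 2 * (2 ^ n * 2) ^ M) (hM2 : 4 * M ^ 2 ≤ 2 ^ n)
    (hp : 1 - ENNReal.ofReal (1 / 2) ≤ (k : ℝ≥0∞) * (((2 ^ n * 2 : ℕ) : ℝ≥0∞)⁻¹) ^ M) : False := by
  have h1 := ENNReal.toReal_mono (by
    refine ENNReal.mul_ne_top (by simp) (ENNReal.pow_ne_top ?_)
    simp) hp
  rw [ENNReal.toReal_sub_of_le (by rw [ENNReal.ofReal_le_one]; norm_num) (by simp),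
    ENNReal.toReal_ofReal (by norm_num)] at h1
  simp only [ENNReal.toReal_mul, ENNReal.toReal_natCast, ENNReal.toReal_inv, ENNReal.toReal_pow,
    ENNReal.toReal_one] at h1
  have h2 : (k : ℝ) * 2 ^ n ≤ M ^ 2 * (2 ^ n * 2) ^ M := by exact_mod_cast hle
  have h3 : (4 : ℝ) * M ^ 2 ≤ 2 ^ n := by exact_mod_cast hM2
  have h2n : (0 : ℝ) < 2 ^ n := by positivity
  push_cast at h1
  rw [inv_pow, ← div_eq_mul_inv] at h1
  have hQ : (0 : ℝ) < (2 ^ n * 2) ^ M := by positivity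
  rw [le_div_iff₀ hQ] at h1
  generalize ((2 : ℝ) ^ n * 2) ^ M = Q at h1 h2 hQ
  generalize (2 : ℝ) ^ n = R at h2 h3 h2n
  have h4 : Q * R ≤ 2 * (k * R) := by nlinarith
  have h5 : (4 * (M : ℝ) ^ 2) * Q ≤ R * Q := by gcongr
  have h6 : 0 < Q * R := by positivity
  nlinarith

lemma err_aux (n w : ℕ) (hw : 2 ^ n ≤ 2 * w)
    (herr : (w : ℝ≥0∞) * ((2 ^ n * 2 : ℕ) : ℝ≥0∞)⁻¹ ≤ ENNReal.ofReal (1 / 8)) : False := by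
  have h1 := ENNReal.toReal_mono (by simp) herr
  rw [ENNReal.toReal_ofReal (by norm_num)] at h1
  simp only [ENNReal.toReal_mul, ENNReal.toReal_natCast, ENNReal.toReal_inv] at h1
  have hw2 : (2 : ℝ) ^ n ≤ 2 * w := by exact_mod_cast hw
  have h2n : (0 : ℝ) < 2 ^ n := by positivity
  push_cast at h1
  rw [← div_eq_mul_inv, div_le_div_iff₀ (by positivity) (by norm_num)] at h1
  linarith

lemma mem_filt {α : Type} {s : Finset α} {p : α → Prop} {h : DecidablePred p} (a : α) :
    a ∈ @Finset.filter α p h s ↔ a ∈ s ∧ p a := Finset.mem_filter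

lemma core (O : Set Op) (Alg : Set Ex → Set Ex → ALC)
    (hyp : ∀ n : ℕ, 0 < n → ∃ (e : (Fin n → Bool) × Bool → Ex) (T : ALC),
      (∀ i, Boxed (e i) (4 * n + 8)) ∧ T.InLang O ∧ T.size ≤ 4 * n + 8 ∧
      (∀ A ∈ T.conceptNames, A < 4 * n + 8) ∧ (∀ A ∈ T.roleNames, A < 4 * n + 8) ∧
      ∀ (M : ℕ) (g : Fin M → (Fin n → Bool) × Bool), 2 * M ≤ 2 ^ n →
        (Function.Injective fun i => (g i).1) →
        2 ^ n ≤ 2 * (wrongSet e T (Alg (posOf (fun i => e (g i)) T)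
          (negOf (fun i => e (g i)) T))).card) :
    ¬SampleEfficientPAC O Alg := by
  classical
  rintro ⟨m, ⟨c, d, hm⟩, hpac⟩
  obtain ⟨n, hn, hbig⟩ := poly_exp (4 * c ^ 2 * (3000 ^ d) ^ 2) (2 * (3 * d))
  obtain ⟨e, T, hbox, hTL, hTs, hTc, hTr, hwrong⟩ := hyp n hn
  set N := 4 * n + 8 with hN
  set D := (PMF.uniformOfFintype ((Fin n → Bool) × Bool)).map e with hD
  have hdist : DistOverSig D (Set.Iio N) (Set.Iio N) (N * N + N * (N * N) + 1) := by
    intro a ha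
    have : a ∈ D.support := ha
    rw [hD, PMF.support_map] at this
    obtain ⟨i, -, rfl⟩ := this
    exact ⟨(hbox i).isExample, (hbox i).size, (hbox i).2.2.2.1, (hbox i).2.2.2.2⟩
  have hp := hpac (1 / 8) (1 / 2) (by norm_num) (by norm_num) (by norm_num) (by norm_num)
    (Set.Iio N) (Set.Iio N) (Set.finite_Iio N) (Set.finite_Iio N) _ N D hdist T hTL
    (fun A hA => hTc A hA) (fun A hA => hTr A hA) hTs
  have hMb := hm (1 / (1 / 2)) (1 / (1 / 8)) ((Set.Iio N).ncard + (Set.Iio N).ncard)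
    (N * N + N * (N * N) + 1) N
  generalize m (1 / (1 / 2)) (1 / (1 / 8)) ((Set.Iio N).ncard + (Set.Iio N).ncard)
    (N * N + N * (N * N) + 1) N = M at hp hMb
  have hM1 : M ≤ c * (3000 ^ d * (n + 1) ^ (3 * d)) := by
    refine bound_aux n c d N M _ hN ?_ hMb
    rw [← Finset.coe_Iio, Set.ncard_coe_finset]; simp
  have hM2 : 4 * M ^ 2 ≤ 2 ^ n := bound_aux2 n c d M _ hM1 hbig
  have hM3 : 2 * M ≤ 2 ^ n := by
    rcases Nat.eq_zero_or_pos M with h | h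
    · subst h; simp
    · nlinarith
  set Succ : Set (Fin M → Ex) := {f | (Alg (posOf f T) (negOf f T)).InLang O ∧
    errP D T (Alg (posOf f T) (negOf f T)) ≤ ENNReal.ofReal (1 / 8)} with hSucc
  have hcardι : Fintype.card ((Fin n → Bool) × Bool) = 2 ^ n * 2 := by simp
  rw [hD, iidProb_eq, hcardι] at hp
  have hb := birthday (X := Fin n → Bool) (Y := Bool) M
  have hX : Fintype.card (Fin n → Bool) = 2 ^ n := by simp
  rw [hcardι, hX] at hb
  refine final_aux n M _ (le_trans (Nat.mul_le_mul_right _ (Finset.card_le_card ?_)) hb) hM2 hp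
  intro g hg
  refine (mem_filt _).2 ⟨Finset.mem_univ _, fun hinj => ?_⟩
  replace hg := ((mem_filt _).1 hg).2
  have hw := hwrong M g hM3 hinj
  have herr := hg.2
  unfold errP at herr
  rw [hD, probOf_eq, hcardι] at herr
  have hw' : (wrongSet e T (Alg (posOf (fun i => e (g i)) T) (negOf (fun i => e (g i)) T))).card =
    (Finset.univ.filter fun i => e i ∈ {a : Ex | Xor' (a.2 ∈ T.sem a.1)
      (a.2 ∈ (Alg (posOf (fun i => e (g i)) T) (negOf (fun i => e (g i)) T)).sem a.1)}).card := by
    unfold wrongSet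
    congr
  rw [← hw'] at herr
  generalize (wrongSet e T (Alg (posOf (fun i => e (g i)) T)
    (negOf (fun i => e (g i)) T))).card = w at hw herr
  exact err_aux n w hw herr

lemma samp {M : ℕ} (f : Fin M → Ex) (T : ALC) (hf : ∀ i, IsExample (f i)) :
    (posOf f T).Finite ∧ (negOf f T).Finite ∧ (∀ a ∈ posOf f T ∪ negOf f T, IsExample a) ∧
      Fits T (posOf f T) (negOf f T) := by
  refine ⟨(Set.finite_range f).subset fun a ha => ha.1, (Set.finite_range f).subset fun a ha => ha.1,
    ?_, fun a ha => ha.2, fun a ha => ha.2⟩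
  rintro a (⟨⟨i, rfl⟩, -⟩ | ⟨⟨i, rfl⟩, -⟩) <;> exact hf i

lemma count_aux {n M : ℕ} (g : Fin M → (Fin n → Bool) × Bool) (h : 2 * M ≤ 2 ^ n)
    (W : Finset ((Fin n → Bool) × Bool)) (hW : ∀ y, (∀ i, (g i).1 ≠ y) → (y, true) ∈ W) :
    2 ^ n ≤ 2 * W.card := by
  classical
  have h1 : (Finset.univ \ Finset.univ.image fun i => (g i).1).card ≤ W.card := by
    refine Finset.card_le_card_of_injOn (fun y => (y, true)) ?_ ?_
    · intro y hy
      refine hW y fun i hi => ?_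
      simp only [Finset.coe_sdiff, Finset.coe_image] at hy
      exact hy.2 ⟨i, by simp, hi⟩
    · intro a _ b _ hab; exact congrArg Prod.fst hab
  have h2 := Finset.le_card_sdiff (Finset.univ.image fun i => (g i).1) (Finset.univ : Finset (Fin n → Bool))
  have h3 : (Finset.univ.image fun i => (g i).1).card ≤ M := by
    simpa using Finset.card_image_le (s := Finset.univ) (f := fun i => (g i).1)
  have h4 : (Finset.univ : Finset (Fin n → Bool)).card = 2 ^ n := by simp
  omega

lemma count_aux2 {n : ℕ} (W : Finset ((Fin n → Bool) × Bool)) (s : (Fin n → Bool) → Bool)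
    (hW : ∀ y, (y, s y) ∈ W) : 2 ^ n ≤ 2 * W.card := by
  have h1 : (Finset.univ : Finset (Fin n → Bool)).card ≤ W.card := by
    refine Finset.card_le_card_of_injOn (fun y => (y, s y)) (fun y _ => hW y) ?_
    intro a _ b _ hab; exact congrArg Prod.fst hab
  have h4 : (Finset.univ : Finset (Fin n → Bool)).card = 2 ^ n := by simp
  omega

lemma ms_easy (O : Set Op) (hq : Op.ex ∈ O ∨ Op.all ∈ O)
    (hcl : ∀ C D : ALC, C.InLang O → D.InLang O →
      ∃ E : ALC, E.InLang O ∧ ∀ I : Interp, I.WF → E.sem I = C.sem I ∩ D.sem I)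
    (Alg : Set Ex → Set Ex → ALC) (hAlg : IsFittingAlg O Alg) (h : ReturnsMostSpecific O Alg) :
    ¬SampleEfficientPAC O Alg := by
  refine core O Alg fun n hn => ?_
  obtain ⟨e, D, T', hbox, -, -, -, -, hDL, hD, -, -⟩ := family O hq false n hn
  refine ⟨e, .top, hbox, trivial, by simp [ALC.size], by simp [ALC.conceptNames],
    by simp [ALC.roleNames], fun M g hM _ => ?_⟩
  obtain ⟨s1, s2, s3, s4⟩ := samp (fun i => e (g i)) .top fun i => (hbox _).isExample
  have hA := hAlg _ _ s1 s2 s3 ⟨.top, trivial, s4⟩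
  have hS := (h _ _ s1 s2 s3 ⟨.top, trivial, s4⟩).2
  set P := posOf (fun i => e (g i)) .top
  set N := negOf (fun i => e (g i)) .top
  set H := Alg P N
  refine count_aux g hM _ fun y hy => ?_
  rw [mem_wrongSet]
  have htop : (e (y, true)).2 ∈ ALC.sem .top (e (y, true)).1 := (hbox _).2.1
  intro hiff
  have hH := hiff.1 htop
  obtain ⟨E, hEL, hE⟩ := hcl H (D y) hA.1 (hDL y).1
  apply hS
  refine ⟨E, hEL, ⟨?_, ?_⟩, ?_, ?_⟩
  · rintro a ⟨⟨i, rfl⟩, ha⟩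
    rw [hE _ (hbox _).1]
    refine ⟨hA.2.1 _ ⟨⟨i, rfl⟩, ha⟩, ?_⟩
    exact (hD _ _).2 (by simpa using hy i)
  · rintro a ⟨⟨i, rfl⟩, ha⟩
    exact absurd ((hbox _).2.1) ha
  · intro I hI; rw [hE I hI]; exact Set.inter_subset_left
  · intro hc
    have := hc.2 _ (hbox _).1 hH
    rw [hE _ (hbox _).1] at this
    have := (hD _ _).1 this.2
    simp at this

lemma mg_easy (O : Set Op) (hq : Op.ex ∈ O ∨ Op.all ∈ O)
    (hcl : ∀ C D : ALC, C.InLang O → D.InLang O →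
      ∃ E : ALC, E.InLang O ∧ ∀ I : Interp, I.WF → E.sem I = C.sem I ∪ D.sem I)
    (Alg : Set Ex → Set Ex → ALC) (hAlg : IsFittingAlg O Alg) (h : ReturnsMostGeneral O Alg) :
    ¬SampleEfficientPAC O Alg := by
  refine core O Alg fun n hn => ?_
  obtain ⟨e, D, T', hbox, -, -, -, -, hDL, hD, -, -⟩ := family O hq true n hn
  refine ⟨e, .bot, hbox, trivial, by simp [ALC.size], by simp [ALC.conceptNames],
    by simp [ALC.roleNames], fun M g hM _ => ?_⟩
  obtain ⟨s1, s2, s3, s4⟩ := samp (fun i => e (g i)) .bot fun i => (hbox _).isExample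
  have hA := hAlg _ _ s1 s2 s3 ⟨.bot, trivial, s4⟩
  have hS := (h _ _ s1 s2 s3 ⟨.bot, trivial, s4⟩).2
  set P := posOf (fun i => e (g i)) .bot
  set N := negOf (fun i => e (g i)) .bot
  set H := Alg P N
  refine count_aux g hM _ fun y hy => ?_
  rw [mem_wrongSet]
  intro hiff
  have hH : (e (y, true)).2 ∉ H.sem (e (y, true)).1 := fun hh => hiff.2 hh
  obtain ⟨E, hEL, hE⟩ := hcl H (D y) hA.1 (hDL y).1
  apply hS
  refine ⟨E, hEL, ⟨?_, ?_⟩, ?_, ?_⟩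
  · rintro a ⟨⟨i, rfl⟩, ha⟩
    exact ha.elim
  · rintro a ⟨⟨i, rfl⟩, ha⟩
    rw [hE _ (hbox _).1]
    rintro (hh | hh)
    · exact hA.2.2 _ ⟨⟨i, rfl⟩, ha⟩ hh
    · exact hy i (by simpa using (hD _ _).1 hh)
  · intro I hI; rw [hE I hI]; exact Set.subset_union_left
  · intro hc
    refine hH (hc.2 _ (hbox _).1 ?_)
    rw [hE _ (hbox _).1]
    exact Or.inr ((hD _ _).2 (by simp))

/-- iterated conjunction -/
def bigI : List ALC → ALC
  | [] => .top
  | c :: l => .inter c (bigI l)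

/-- iterated disjunction -/
def bigU : List ALC → ALC
  | [] => .bot
  | c :: l => .union c (bigU l)

lemma bigI_sem (I : Interp) (a : ℕ) (ha : a ∈ I.dom) (l : List ALC) :
    a ∈ (bigI l).sem I ↔ ∀ C ∈ l, a ∈ C.sem I := by
  induction l with
  | nil => simp [bigI, ALC.sem, ha]
  | cons c l ih => simp [bigI, ALC.sem, ih]

lemma bigU_sem (I : Interp) (a : ℕ) (l : List ALC) :
    a ∈ (bigU l).sem I ↔ ∃ C ∈ l, a ∈ C.sem I := by
  induction l with
  | nil => simp [bigU, ALC.sem]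
  | cons c l ih => simp [bigU, ALC.sem, ih]

lemma bigI_lang {O : Set Op} (h : Op.inter ∈ O) (l : List ALC) (hl : ∀ C ∈ l, C.InLang O) :
    (bigI l).InLang O := by
  induction l with
  | nil => trivial
  | cons c l ih => exact ⟨h, hl c (by simp), ih fun C hC => hl C (by simp [hC])⟩

lemma bigU_lang {O : Set Op} (h : Op.union ∈ O) (l : List ALC) (hl : ∀ C ∈ l, C.InLang O) :
    (bigU l).InLang O := by
  induction l with
  | nil => trivial
  | cons c l ih => exact ⟨h, hl c (by simp), ih fun C hC => hl C (by simp [hC])⟩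

lemma bigI_qd (n : ℕ) (l : List ALC) (hl : ∀ C ∈ l, C.qdepth ≤ n) : (bigI l).qdepth ≤ n := by
  induction l with
  | nil => simp [bigI, ALC.qdepth]
  | cons c l ih => exact max_le (hl c (by simp)) (ih fun C hC => hl C (by simp [hC]))

lemma bigU_qd (n : ℕ) (l : List ALC) (hl : ∀ C ∈ l, C.qdepth ≤ n) : (bigU l).qdepth ≤ n := by
  induction l with
  | nil => simp [bigU, ALC.qdepth]
  | cons c l ih => exact max_le (hl c (by simp)) (ih fun C hC => hl C (by simp [hC]))

lemma md_case (O : Set Op) (hq : Op.ex ∈ O ∨ Op.all ∈ O) (hc : Op.inter ∈ O ∨ Op.union ∈ O)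
    (Alg : Set Ex → Set Ex → ALC) (h : ReturnsMinQDepth O Alg) :
    ¬SampleEfficientPAC O Alg := by
  classical
  refine core O Alg fun n hn => ?_
  have main : ∃ (e : (Fin n → Bool) × Bool → Ex) (T : ALC),
      (∀ i, Boxed (e i) (4 * n + 8)) ∧ T.InLang O ∧ T.size ≤ 4 * n + 8 ∧
      (∀ A ∈ T.conceptNames, A < 4 * n + 8) ∧ (∀ A ∈ T.roleNames, A < 4 * n + 8) ∧
      (∀ x, ¬((e (x, true)).2 ∈ T.sem (e (x, true)).1 ↔
        (e (x, false)).2 ∈ T.sem (e (x, false)).1)) ∧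
      (∀ H : ALC, H.qdepth ≤ n → ∀ x, ((e (x, true)).2 ∈ H.sem (e (x, true)).1 ↔
        (e (x, false)).2 ∈ H.sem (e (x, false)).1)) ∧
      ∀ (M : ℕ) (g : Fin M → (Fin n → Bool) × Bool), (Function.Injective fun i => (g i).1) →
        ∃ G : ALC, G.InLang O ∧ G.qdepth ≤ n ∧
          Fits G (posOf (fun i => e (g i)) T) (negOf (fun i => e (g i)) T) := by
    rcases hc with hc | hc
    · obtain ⟨e, D, T, hbox, t1, t2, t3, t4, hDL, hD, hT, hag⟩ := family O hq false n hn
      refine ⟨e, T, hbox, t1, t2, t3, t4, hT, hag, fun M g hg => ?_⟩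
      refine ⟨bigI ((Finset.univ.filter fun x : Fin n → Bool => ∃ i, (g i).1 = x ∧
        (e (g i)).2 ∉ T.sem (e (g i)).1).toList.map D), bigI_lang hc _ ?_, bigI_qd _ _ ?_, ?_, ?_⟩
      · simp only [List.mem_map]; rintro C ⟨x, -, rfl⟩; exact (hDL x).1
      · simp only [List.mem_map]; rintro C ⟨x, -, rfl⟩; exact (hDL x).2
      · rintro a ⟨⟨j, rfl⟩, ha⟩
        rw [bigI_sem _ _ (hbox _).2.1]
        simp only [List.mem_map, Finset.mem_toList, Finset.mem_filter, Finset.mem_univ, true_and]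
        rintro C ⟨x, ⟨i, rfl, hi⟩, rfl⟩
        refine (hD _ _).2 ?_
        simp only [Bool.false_eq_true, if_false]
        intro hh
        have := hg hh
        subst this
        exact hi ha
      · rintro a ⟨⟨j, rfl⟩, ha⟩
        rw [bigI_sem _ _ (hbox _).2.1]
        intro hall
        have := hall (D (g j).1) (by
          simp only [List.mem_map, Finset.mem_toList, Finset.mem_filter, Finset.mem_univ, true_and]
          exact ⟨_, ⟨j, rfl, ha⟩, rfl⟩)
        have := (hD _ _).1 this
        simp at this
    · obtain ⟨e, D, T, hbox, t1, t2, t3, t4, hDL, hD, hT, hag⟩ := family O hq true n hn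
      refine ⟨e, T, hbox, t1, t2, t3, t4, hT, hag, fun M g hg => ?_⟩
      refine ⟨bigU ((Finset.univ.filter fun x : Fin n → Bool => ∃ i, (g i).1 = x ∧
        (e (g i)).2 ∈ T.sem (e (g i)).1).toList.map D), bigU_lang hc _ ?_, bigU_qd _ _ ?_, ?_, ?_⟩
      · simp only [List.mem_map]; rintro C ⟨x, -, rfl⟩; exact (hDL x).1
      · simp only [List.mem_map]; rintro C ⟨x, -, rfl⟩; exact (hDL x).2
      · rintro a ⟨⟨j, rfl⟩, ha⟩
        rw [bigU_sem]
        refine ⟨D (g j).1, ?_, (hD _ _).2 (by simp)⟩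
        simp only [List.mem_map, Finset.mem_toList, Finset.mem_filter, Finset.mem_univ, true_and]
        exact ⟨_, ⟨j, rfl, ha⟩, rfl⟩
      · rintro a ⟨⟨j, rfl⟩, ha⟩
        rw [bigU_sem]
        simp only [List.mem_map, Finset.mem_toList, Finset.mem_filter, Finset.mem_univ, true_and]
        rintro ⟨C, ⟨x, ⟨i, rfl, hi⟩, rfl⟩, hh⟩
        have hh := (hD _ _).1 hh
        simp only [if_true] at hh
        have := hg hh
        subst this
        exact ha hi
  obtain ⟨e, T, hbox, t1, t2, t3, t4, hT, hag, hG⟩ := main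
  refine ⟨e, T, hbox, t1, t2, t3, t4, fun M g hM hg => ?_⟩
  obtain ⟨s1, s2, s3, s4⟩ := samp (fun i => e (g i)) T fun i => (hbox _).isExample
  obtain ⟨G, hGL, hGd, hGf⟩ := hG M g hg
  have hd := ((h _ _ s1 s2 s3 ⟨T, t1, s4⟩).2 G hGL hGf).trans hGd
  set H := Alg (posOf (fun i => e (g i)) T) (negOf (fun i => e (g i)) T)
  have hx : ∀ x, ∃ s, (x, s) ∈ wrongSet e T H := by
    intro x
    by_contra hcon
    push Not at hcon
    have h1 := hcon true
    have h2 := hcon false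
    rw [mem_wrongSet, not_not] at h1 h2
    have h3 := hag H hd x
    exact hT x (h1.trans (h3.trans h2.symm))
  choose s hs using hx
  exact count_aux2 _ s hs


/-- star interpretation -/
def star (K : Set ℕ) (L : ℕ → ℕ → Prop) : Interp where
  dom := insert 0 K
  cI := fun A => {k | k ∈ K ∧ L k A}
  rI := fun r => {p | r = 0 ∧ p.1 = 0 ∧ p.2 ∈ K}

/-- truth at a leaf -/
def leaf : ALC → (ℕ → Prop) → Prop
  | .bot, _ => False
  | .top, _ => True
  | .atom A, L => L A
  | .neg c, L => ¬ leaf c L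
  | .inter c d, L => leaf c L ∧ leaf d L
  | .union c d, L => leaf c L ∨ leaf d L
  | .all _ _, _ => True
  | .ex _ _, _ => False

lemma star_leaf (K : Set ℕ) (L : ℕ → ℕ → Prop) (h0 : 0 ∉ K) (k : ℕ) (hk : k ∈ K) (C : ALC) :
    k ∈ C.sem (star K L) ↔ leaf C (L k) := by
  have hk0 : k ≠ 0 := fun h => h0 (h ▸ hk)
  induction C with
  | bot => simp [ALC.sem, leaf]
  | top => simp [ALC.sem, leaf, star, hk]
  | atom A => simp [ALC.sem, leaf, star, hk]
  | neg c ih => simp [ALC.sem, leaf, ih]; simp [star, hk]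
  | inter c d ih1 ih2 => simp [ALC.sem, leaf, ih1, ih2]
  | union c d ih1 ih2 => simp [ALC.sem, leaf, ih1, ih2]
  | all r c ih => simp [ALC.sem, leaf, star, hk, hk0]
  | ex r c ih => simp [ALC.sem, leaf, star, hk0]

lemma star_all (K : Set ℕ) (L : ℕ → ℕ → Prop) (h0 : 0 ∉ K) (r : ℕ) (C : ALC) :
    0 ∈ (ALC.all r C).sem (star K L) ↔ (r = 0 → ∀ k ∈ K, leaf C (L k)) := by
  have h1 : (0 : ℕ) ∈ (star K L).dom := Set.mem_insert _ _
  simp only [ALC.sem, Set.mem_setOf_eq, h1, true_and]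
  constructor
  · intro h hr k hk
    exact (star_leaf K L h0 k hk C).1 (h k ⟨hr, rfl, hk⟩)
  · rintro h k ⟨hr, -, hk⟩
    exact (star_leaf K L h0 k hk C).2 (h hr k hk)

lemma star_ex (K : Set ℕ) (L : ℕ → ℕ → Prop) (h0 : 0 ∉ K) (r : ℕ) (C : ALC) :
    0 ∈ (ALC.ex r C).sem (star K L) ↔ (r = 0 ∧ ∃ k ∈ K, leaf C (L k)) := by
  simp only [ALC.sem, Set.mem_setOf_eq]
  constructor
  · rintro ⟨k, ⟨hr, -, hk⟩, h⟩
    exact ⟨hr, k, hk, (star_leaf K L h0 k hk C).1 h⟩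
  · rintro ⟨hr, k, hk, h⟩
    exact ⟨k, ⟨hr, rfl, hk⟩, (star_leaf K L h0 k hk C).2 h⟩

lemma star_boxed (K : Set ℕ) (L : ℕ → ℕ → Prop) (N : ℕ) (hN : 0 < N) (hK : ∀ k ∈ K, k < N)
    (hL : ∀ k A, L k A → A < N) : Boxed (star K L, 0) N := by
  refine ⟨⟨⟨0, Set.mem_insert _ _⟩, fun A k hk => Set.mem_insert_of_mem _ hk.1, ?_⟩,
    Set.mem_insert _ _, ?_, ?_, ?_⟩
  · rintro r ⟨a, b⟩ ⟨-, h1, h2⟩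
    exact ⟨Set.mem_insert_iff.2 (Or.inl h1), Set.mem_insert_of_mem _ h2⟩
  · rintro a (rfl | ha)
    · exact hN
    · exact hK a ha
  · rintro A ⟨k, -, hk⟩; exact hL k A hk
  · rintro r ⟨p, rfl, -⟩; exact hN

lemma leaf_mono {O : Set Op} (hn : Op.neg ∉ O) (L L' : ℕ → Prop) (h : ∀ A, L A → L' A) (C : ALC)
    (hC : C.InLang O) : leaf C L → leaf C L' := by
  induction C with
  | bot => exact id
  | top => exact id
  | atom A => exact h A
  | neg c ih => exact absurd hC.1 hn
  | inter c d ih1 ih2 => exact fun hh => ⟨ih1 hC.2.1 hh.1, ih2 hC.2.2 hh.2⟩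
  | union c d ih1 ih2 => exact fun hh => hh.imp (ih1 hC.2.1) (ih2 hC.2.2)
  | all r c ih => exact id
  | ex r c ih => exact id

lemma leaf_bigI (l : List ALC) (L : ℕ → Prop) : leaf (bigI l) L ↔ ∀ C ∈ l, leaf C L := by
  induction l with
  | nil => simp [bigI, leaf]
  | cons c l ih => simp [bigI, leaf, ih]

lemma leaf_bigU (l : List ALC) (L : ℕ → Prop) : leaf (bigU l) L ↔ ∃ C ∈ l, leaf C L := by
  induction l with
  | nil => simp [bigU, leaf]
  | cons c l ih => simp [bigU, leaf, ih]

lemma leaf_del {O : Set Op} (hn : Op.neg ∉ O) (hu : Op.union ∉ O) (L : ℕ → Prop) (B : ℕ) (C : ALC)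
    (hC : C.InLang O) (h : leaf C L) (hB : ¬ Subsume C (.atom B)) :
    leaf C (fun A => L A ∧ A ≠ B) := by
  induction C with
  | bot => exact h
  | top => exact h
  | atom A => exact ⟨h, fun hh => hB (hh ▸ fun _ _ => subset_rfl)⟩
  | neg c ih => exact absurd hC.1 hn
  | inter c d ih1 ih2 =>
    exact ⟨ih1 hC.2.1 h.1 fun hh => hB fun I hI a ha => hh I hI ha.1,
      ih2 hC.2.2 h.2 fun hh => hB fun I hI a ha => hh I hI ha.2⟩
  | union c d ih1 ih2 => exact absurd hC.1 hu
  | all r c ih => exact h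
  | ex r c ih => exact h

lemma leaf_add {O : Set Op} (hn : Op.neg ∉ O) (hu : Op.inter ∉ O) (L : ℕ → Prop) (B : ℕ) (C : ALC)
    (hC : C.InLang O) (h : ¬ leaf C L) (hB : ¬ Subsume (.atom B) C) :
    ¬ leaf C (fun A => L A ∨ A = B) := by
  induction C with
  | bot => exact h
  | top => exact h
  | atom A =>
    rintro (hh | hh)
    · exact h hh
    · exact hB (hh ▸ fun _ _ => subset_rfl)
  | neg c ih => exact absurd hC.1 hn
  | union c d ih1 ih2 =>
    rintro (hh | hh)
    · exact ih1 hC.2.1 (fun hh => h (Or.inl hh)) (fun hh => hB fun I hI a ha => Or.inl (hh I hI ha)) hh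
    · exact ih2 hC.2.2 (fun hh => h (Or.inr hh)) (fun hh => hB fun I hI a ha => Or.inr (hh I hI ha)) hh
  | inter c d ih1 ih2 => exact absurd hC.1 hu
  | all r c ih => exact h
  | ex r c ih => exact h

/-- conjunction of atoms under an existential -/
def DE (n : ℕ) (X : ℕ → ℕ) : ALC := .ex 0 (bigI ((List.range n).map fun i => .atom (X i)))
/-- disjunction of atoms under a universal -/
def DA (n : ℕ) (X : ℕ → ℕ) : ALC := .all 0 (bigU ((List.range n).map fun i => .atom (X i)))

lemma DE_lang {O : Set Op} (h1 : Op.ex ∈ O) (h2 : Op.inter ∈ O) (n : ℕ) (X : ℕ → ℕ) :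
    (DE n X).InLang O := by
  refine ⟨h1, bigI_lang h2 _ ?_⟩
  simp only [List.mem_map]; rintro C ⟨i, -, rfl⟩; trivial

lemma DA_lang {O : Set Op} (h1 : Op.all ∈ O) (h2 : Op.union ∈ O) (n : ℕ) (X : ℕ → ℕ) :
    (DA n X).InLang O := by
  refine ⟨h1, bigU_lang h2 _ ?_⟩
  simp only [List.mem_map]; rintro C ⟨i, -, rfl⟩; trivial

lemma bigI_stats (l : List ℕ) : (bigI (l.map ALC.atom)).size = 2 * l.length + 1 ∧
    (bigI (l.map ALC.atom)).conceptNames = l.toFinset ∧ (bigI (l.map ALC.atom)).roleNames = ∅ := by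
  induction l with
  | nil => simp [bigI, ALC.size, ALC.conceptNames, ALC.roleNames]
  | cons a l ih =>
    obtain ⟨h1, h2, h3⟩ := ih
    simp [bigI, ALC.size, ALC.conceptNames, ALC.roleNames, h1, h2, h3]; omega

lemma bigU_stats (l : List ℕ) : (bigU (l.map ALC.atom)).size = 2 * l.length + 1 ∧
    (bigU (l.map ALC.atom)).conceptNames = l.toFinset ∧ (bigU (l.map ALC.atom)).roleNames = ∅ := by
  induction l with
  | nil => simp [bigU, ALC.size, ALC.conceptNames, ALC.roleNames]
  | cons a l ih =>
    obtain ⟨h1, h2, h3⟩ := ih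
    simp [bigU, ALC.size, ALC.conceptNames, ALC.roleNames, h1, h2, h3]; omega

lemma DE_star (K : Set ℕ) (L : ℕ → ℕ → Prop) (h0 : 0 ∉ K) (n : ℕ) (X : ℕ → ℕ) :
    0 ∈ (DE n X).sem (star K L) ↔ ∃ k ∈ K, ∀ i < n, L k (X i) := by
  rw [DE, star_ex K L h0]
  simp [leaf_bigI, leaf]

lemma DA_star (K : Set ℕ) (L : ℕ → ℕ → Prop) (h0 : 0 ∉ K) (n : ℕ) (X : ℕ → ℕ) :
    0 ∈ (DA n X).sem (star K L) ↔ ∀ k ∈ K, ∃ i < n, L k (X i) := by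
  rw [DA, star_all K L h0]
  simp [leaf_bigU, leaf]

/-- index sets of leaves -/
def KK (n : ℕ) (b : Bool) : Set ℕ := if b then {k | k = 1 ∨ (3 ≤ k ∧ k < n + 3)} else {1, 2}

lemma KK0 (n : ℕ) (b : Bool) : 0 ∉ KK n b := by
  cases b <;> simp [KK]

lemma KKlt (n : ℕ) (b : Bool) : ∀ k ∈ KK n b, k < n + 3 := by
  cases b
  · simp [KK]
  · simp [KK]

/-- labels -/
def LE (n : ℕ) (X : ℕ → ℕ) (k A : ℕ) : Prop :=
  if k = 1 then False else if k = 2 then A < 2 * n else (A < 2 * n ∧ A ≠ X (k - 3))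
/-- labels, dual -/
def LA (n : ℕ) (X : ℕ → ℕ) (k A : ℕ) : Prop :=
  if k = 1 then A < 2 * n else if k = 2 then False else (False ∨ A = X (k - 3))

lemma claimE {O : Set Op} (hn : Op.neg ∉ O) (hu : Op.union ∉ O) (n : ℕ) (X : ℕ → ℕ) (C : ALC)
    (hC : C.InLang O) (hp : 0 ∈ C.sem (star (KK n false) (LE n X))) (hD : ¬ Subsume C (DE n X)) :
    0 ∈ C.sem (star (KK n true) (LE n X)) := by
  induction C with
  | bot => exact hp
  | top => exact Set.mem_insert _ _
  | atom A => exact absurd hp.1 (KK0 n false)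
  | neg c ih => exact absurd hC.1 hn
  | inter c d ih1 ih2 =>
    exact ⟨ih1 hC.2.1 hp.1 fun hh => hD fun I hI a ha => hh I hI ha.1,
      ih2 hC.2.2 hp.2 fun hh => hD fun I hI a ha => hh I hI ha.2⟩
  | union c d ih1 ih2 => exact absurd hC.1 hu
  | all r c ih =>
    rw [star_all _ _ (KK0 n _)] at hp ⊢
    intro hr k hk
    have h1 := hp hr 1 (by simp [KK])
    exact leaf_mono hn _ _ (fun A hA => by simp [LE] at hA) c hC.2 h1
  | ex r c ih =>
    rw [star_ex _ _ (KK0 n _)] at hp ⊢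
    obtain ⟨rfl, k, hk, hl⟩ := hp
    refine ⟨rfl, ?_⟩
    have hk : k = 1 ∨ k = 2 := by simpa [KK] using hk
    rcases hk with rfl | rfl
    · exact ⟨1, by simp [KK], hl⟩
    · have : ∃ i < n, ¬ Subsume c (.atom (X i)) := by
        by_contra hcon
        push Not at hcon
        apply hD
        rintro I hI a ⟨b, hab, hb⟩
        refine ⟨b, hab, ?_⟩
        rw [bigI_sem _ _ (hI.2.2 _ _ hab).2]
        simp only [List.mem_map, List.mem_range]
        rintro C ⟨i, hi, rfl⟩
        exact hcon i hi I hI hb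
      obtain ⟨i, hi, hs⟩ := this
      refine ⟨i + 3, by simp [KK, hi], ?_⟩
      have := leaf_del hn hu _ _ c hC.2 hl hs
      refine leaf_mono hn _ _ (fun A hA => ?_) c hC.2 this
      simpa [LE] using hA

lemma claimA {O : Set Op} (hn : Op.neg ∉ O) (hu : Op.inter ∉ O) (n : ℕ) (X : ℕ → ℕ)
    (hX : ∀ i < n, X i < 2 * n) (C : ALC)
    (hC : C.InLang O) (hp : 0 ∉ C.sem (star (KK n false) (LA n X))) (hD : ¬ Subsume (DA n X) C) :
    0 ∉ C.sem (star (KK n true) (LA n X)) := by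
  induction C with
  | bot => exact hp
  | top => exact absurd (Set.mem_insert _ _) hp
  | atom A => exact fun h => absurd h.1 (KK0 n true)
  | neg c ih => exact absurd hC.1 hn
  | union c d ih1 ih2 =>
    rintro (hh | hh)
    · exact ih1 hC.2.1 (fun hh => hp (Or.inl hh)) (fun hh => hD fun I hI a ha => Or.inl (hh I hI ha)) hh
    · exact ih2 hC.2.2 (fun hh => hp (Or.inr hh)) (fun hh => hD fun I hI a ha => Or.inr (hh I hI ha)) hh
  | inter c d ih1 ih2 => exact absurd hC.1 hu
  | ex r c ih =>
    rw [star_ex _ _ (KK0 n _)] at hp ⊢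
    rintro ⟨hr, k, hk, hl⟩
    refine hp ⟨hr, 1, by simp [KK], ?_⟩
    refine leaf_mono hn _ _ (fun A hA => ?_) c hC.2 hl
    have hk : k = 1 ∨ (3 ≤ k ∧ k < n + 3) := by simpa [KK] using hk
    rcases hk with rfl | ⟨h3, h4⟩
    · exact hA
    · have e1 : k ≠ 1 := by omega
      have e2 : k ≠ 2 := by omega
      simp only [LA, e1, e2, if_false, if_true, false_or] at hA ⊢
      rw [hA]; exact hX _ (by omega)
  | all r c ih =>
    rw [star_all _ _ (KK0 n _)] at hp ⊢
    intro hall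
    apply hp
    intro hr k hk
    subst hr
    have hk : k = 1 ∨ k = 2 := by simpa [KK] using hk
    rcases hk with rfl | rfl
    · exact hall rfl 1 (by simp [KK])
    · by_contra hl
      have : ∃ i < n, ¬ Subsume (.atom (X i)) c := by
        by_contra hcon
        push Not at hcon
        apply hD
        rintro I hI a ⟨ha, hb⟩
        refine ⟨ha, fun b hab => ?_⟩
        have := hb b hab
        rw [bigU_sem] at this
        simp only [List.mem_map, List.mem_range] at this
        obtain ⟨C, ⟨i, hi, rfl⟩, hh⟩ := this
        exact hcon i hi I hI hh
      obtain ⟨i, hi, hs⟩ := this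
      refine leaf_add hn hu _ _ c hC.2 hl hs ?_
      refine leaf_mono hn _ _ (fun A hA => ?_) c hC.2 (hall rfl (i + 3) (by simp [KK, hi]))
      simpa [LA] using hA

/-- the atoms selected by a bit string -/
def XX {n : ℕ} (x : Fin n → Bool) (i : ℕ) : ℕ := 2 * i + (extW x i).toNat

lemma XX_lt {n : ℕ} (x : Fin n → Bool) (i : ℕ) (hi : i < n) : XX x i < 2 * n := by
  unfold XX; cases extW x i <;> simp <;> omega

lemma XX_inj {n : ℕ} (x y : Fin n → Bool) (i j : ℕ) (h : XX x i = XX y j) :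
    i = j ∧ extW x i = extW y j := by
  unfold XX at h; revert h; cases extW x i <;> cases extW y j <;> simp <;> omega

lemma XX_ne {n : ℕ} (x y : Fin n → Bool) (h : x ≠ y) : ∃ i < n, extW x i ≠ extW y i := by
  by_contra hcon
  push Not at hcon
  apply h
  funext i
  have := hcon i i.2
  simpa [extW] using this

lemma DE_true {n : ℕ} (x y : Fin n → Bool) :
    0 ∈ (DE n (XX y)).sem (star (KK n true) (LE n (XX x))) ↔ (x ≠ y ∨ n = 0) := by
  rw [DE_star _ _ (KK0 n _)]
  constructor
  · rintro ⟨k, hk, h⟩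
    rcases Nat.eq_zero_or_pos n with h0 | h0
    · exact Or.inr h0
    left
    rintro rfl
    have hk : k = 1 ∨ (3 ≤ k ∧ k < n + 3) := by simpa [KK] using hk
    rcases hk with rfl | ⟨h3, h4⟩
    · simpa [LE] using h 0 h0
    · have := h (k - 3) (by omega)
      have e1 : k ≠ 1 := by omega
      have e2 : k ≠ 2 := by omega
      simp [LE, e1, e2] at this
  · rintro (h | h)
    · obtain ⟨i, hi, hne⟩ := XX_ne x y h
      refine ⟨i + 3, by simp [KK, hi], fun j hj => ?_⟩
      simp only [LE]
      rw [if_neg (by omega), if_neg (by omega)]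
      refine ⟨XX_lt y j hj, fun hh => ?_⟩
      obtain ⟨e1, e2⟩ := XX_inj _ _ _ _ hh
      simp only [Nat.add_sub_cancel] at e1 e2
      subst e1; exact hne e2.symm
    · exact ⟨1, by simp [KK], by omega⟩

lemma DA_true {n : ℕ} (hn : 0 < n) (x y : Fin n → Bool) :
    0 ∈ (DA n (XX y)).sem (star (KK n true) (LA n (XX x))) ↔ x = y := by
  rw [DA_star _ _ (KK0 n _)]
  constructor
  · intro h
    by_contra hne
    obtain ⟨i, hi, hne⟩ := XX_ne x y hne
    obtain ⟨j, hj, hh⟩ := h (i + 3) (by simp [KK, hi])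
    simp only [LA] at hh
    rw [if_neg (by omega), if_neg (by omega)] at hh
    have hh := hh.resolve_left id
    obtain ⟨e1, e2⟩ := XX_inj _ _ _ _ hh
    simp only [Nat.add_sub_cancel] at e1 e2
    subst e1; exact hne e2.symm
  · rintro rfl k hk
    have hk : k = 1 ∨ (3 ≤ k ∧ k < n + 3) := by simpa [KK] using hk
    rcases hk with rfl | ⟨h3, h4⟩
    · exact ⟨0, hn, by simpa [LA] using XX_lt x 0 hn⟩
    · have e1 : k ≠ 1 := by omega
      have e2 : k ≠ 2 := by omega
      exact ⟨k - 3, by omega, by simp [LA, e1, e2]⟩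

lemma mg_hard (O : Set Op) (h1 : Op.ex ∈ O) (h2 : Op.inter ∈ O) (hn' : Op.neg ∉ O)
    (hu : Op.union ∉ O) (Alg : Set Ex → Set Ex → ALC) (hAlg : IsFittingAlg O Alg)
    (h : ReturnsMostGeneral O Alg) : ¬SampleEfficientPAC O Alg := by
  classical
  refine core O Alg fun n hn => ?_
  let e : (Fin n → Bool) × Bool → Ex := fun p => (star (KK n p.2) (LE n (XX p.1)), 0)
  let T : ALC := DE (2 * n) id
  have hbox : ∀ i, Boxed (e i) (4 * n + 8) := fun i => by
    refine star_boxed _ _ _ (by omega) (fun k hk => ?_) ?_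
    · have := KKlt n _ k hk; omega
    · intro k A hA
      unfold LE at hA
      split_ifs at hA <;> omega
  have hTl : T.InLang O := DE_lang h1 h2 _ _
  have hTf : ∀ x, (e (x, false)).2 ∈ T.sem (e (x, false)).1 := fun x => by
    refine (DE_star _ _ (KK0 n _) _ _).2 ⟨2, by simp [KK], fun i hi => by simpa [LE] using hi⟩
  have hTt : ∀ x, (e (x, true)).2 ∉ T.sem (e (x, true)).1 := fun x hx => by
    obtain ⟨k, hk, hh⟩ := (DE_star _ _ (KK0 n _) _ _).1 hx
    have : ¬ (x ≠ x ∨ n = 0) := by simp; omega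
    exact this ((DE_true x x).1 ((DE_star _ _ (KK0 n _) _ _).2 ⟨k, hk, fun i hi => hh _ (XX_lt x i hi)⟩))
  have hDf : ∀ x y, (e (x, false)).2 ∈ (DE n (XX y)).sem (e (x, false)).1 := fun x y => by
    refine (DE_star _ _ (KK0 n _) _ _).2 ⟨2, by simp [KK], fun i hi => by simpa [LE] using XX_lt y i hi⟩
  have st := bigI_stats (List.range (2 * n))
  refine ⟨e, T, hbox, hTl, ?_, ?_, ?_, fun M g hM hg => ?_⟩
  · change (bigI ((List.range (2 * n)).map ALC.atom)).size + 1 ≤ _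
    rw [st.1]; simp; omega
  · change ∀ A ∈ (bigI ((List.range (2 * n)).map ALC.atom)).conceptNames, _
    rw [st.2.1]; simp; intro A hA; omega
  · change ∀ A ∈ insert 0 (bigI ((List.range (2 * n)).map ALC.atom)).roleNames, _
    rw [st.2.2]; simp
  obtain ⟨s1, s2, s3, s4⟩ := samp (fun i => e (g i)) T fun i => (hbox _).isExample
  have hA := hAlg _ _ s1 s2 s3 ⟨T, hTl, s4⟩
  have hS := (h _ _ s1 s2 s3 ⟨T, hTl, s4⟩).2
  set P := posOf (fun i => e (g i)) T
  set N := negOf (fun i => e (g i)) T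
  set H := Alg P N
  by_cases hp : ∀ y, (y, false) ∈ wrongSet e T H
  · exact count_aux2 _ (fun _ => false) hp
  push Not at hp
  obtain ⟨y0, hy0⟩ := hp
  rw [mem_wrongSet, not_not] at hy0
  have hH0 := hy0.1 (hTf y0)
  have hHf : ∀ x, (e (x, false)).2 ∈ H.sem (e (x, false)).1 := by
    have : ∀ x, e (x, false) = e (y0, false) := by
      intro x
      simp only [e, Prod.mk.injEq, and_true, star, Interp.mk.injEq, true_and]
      funext A
      ext k
      simp only [KK, Set.mem_setOf_eq, Bool.false_eq_true, if_false, Set.mem_insert_iff,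
        Set.mem_singleton_iff]
      constructor <;> rintro ⟨rfl | rfl, hh⟩ <;> simp [LE] at hh ⊢ <;> exact hh
    intro x; rw [this x]; exact hH0
  let S : Finset (Fin n → Bool) := Finset.univ.filter fun x => ∃ i, g i = (x, true)
  let G := bigI (S.toList.map fun x => DE n (XX x))
  have hGl : G.InLang O := by
    refine bigI_lang h2 _ ?_
    simp only [List.mem_map]; rintro C ⟨i, -, rfl⟩; exact DE_lang h1 h2 _ _
  have hGs : ∀ (I : Interp) (a : ℕ), a ∈ I.dom →
      (a ∈ G.sem I ↔ ∀ x, (∃ i, g i = (x, true)) → a ∈ (DE n (XX x)).sem I) := by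
    intro I a ha
    rw [bigI_sem _ _ ha]
    simp only [List.mem_map, Finset.mem_toList, S, Finset.mem_filter, Finset.mem_univ, true_and]
    constructor
    · exact fun hh x hx => hh _ ⟨x, hx, rfl⟩
    · rintro hh C ⟨x, hx, rfl⟩; exact hh x hx
  have hHG : Subsume H G := by
    intro I hI a ha
    rw [hGs I a (sem_sub_dom _ _ hI ha)]
    rintro x ⟨i, hi⟩
    by_contra hcon
    have h3 := claimE hn' hu n (XX x) H hA.1 (hHf x) fun hs => hcon (hs I hI ha)
    exact hA.2.2 (e (x, true)) ⟨⟨i, by simp [hi]⟩, hTt x⟩ h3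
  have hGf : Fits G P N := by
    constructor
    · exact fun a ha => by
        obtain ⟨⟨i, rfl⟩, hi⟩ := ha
        exact hHG _ (hbox _).1 (hA.2.1 _ ⟨⟨i, rfl⟩, hi⟩)
    · rintro a ⟨⟨i, rfl⟩, hi⟩ hh
      rcases hgi : g i with ⟨x, b⟩
      simp only [hgi] at hh hi
      cases b
      · exact hi (hTf x)
      · have := (hGs _ _ (hbox _).2.1).1 hh x ⟨i, hgi⟩
        have := (DE_true x x).1 this
        simp at this; omega
  have hGH : Subsume G H := by
    by_contra hcon
    exact hS ⟨G, hGl, hGf, hHG, fun hc => hcon hc.2⟩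
  refine count_aux g hM _ fun y hy => ?_
  rw [mem_wrongSet]
  intro hiff
  refine hTt y (hiff.2 (hGH _ (hbox _).1 ((hGs _ _ (hbox _).2.1).2 ?_)))
  rintro x ⟨i, hi⟩
  refine (DE_true y x).2 (Or.inl fun hyx => hy i ?_)
  rw [hi]; exact hyx.symm

lemma ms_hard (O : Set Op) (h1 : Op.all ∈ O) (h2 : Op.union ∈ O) (hn' : Op.neg ∉ O)
    (hu : Op.inter ∉ O) (Alg : Set Ex → Set Ex → ALC) (hAlg : IsFittingAlg O Alg)
    (h : ReturnsMostSpecific O Alg) : ¬SampleEfficientPAC O Alg := by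
  classical
  refine core O Alg fun n hn => ?_
  let e : (Fin n → Bool) × Bool → Ex := fun p => (star (KK n p.2) (LA n (XX p.1)), 0)
  let T : ALC := DA (2 * n) id
  have hbox : ∀ i, Boxed (e i) (4 * n + 8) := fun i => by
    have : e i = (star (KK n i.2) (fun k A => k ∈ KK n i.2 ∧ LA n (XX i.1) k A), 0) := by
      simp [e, star]
    rw [this]
    refine star_boxed _ _ _ (by omega) (fun k hk => ?_) ?_
    · have := KKlt n _ k hk; omega
    · rintro k A ⟨hk, hA⟩
      have := KKlt n _ k hk
      have h0 : k ≠ 0 := fun h0 => KK0 n _ (h0 ▸ hk)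
      unfold LA at hA
      split_ifs at hA
      · omega
      · have := XX_lt i.1 (k - 3) (by omega)
        have := hA.resolve_left id
        omega
  have hTl : T.InLang O := DA_lang h1 h2 _ _
  have hTf : ∀ x, (e (x, false)).2 ∉ T.sem (e (x, false)).1 := fun x hx => by
    obtain ⟨i, hi, hh⟩ := (DA_star _ _ (KK0 n _) _ _).1 hx 2 (by simp [KK])
    simp [LA] at hh
  have hTt : ∀ x, (e (x, true)).2 ∈ T.sem (e (x, true)).1 := fun x => by
    refine (DA_star _ _ (KK0 n _) _ _).2 fun k hk => ?_
    obtain ⟨i, hi, hh⟩ := (DA_star _ _ (KK0 n _) _ _).1 ((DA_true hn x x).2 rfl) k hk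
    exact ⟨_, XX_lt x i hi, hh⟩
  have st := bigU_stats (List.range (2 * n))
  refine ⟨e, T, hbox, hTl, ?_, ?_, ?_, fun M g hM hg => ?_⟩
  · change (bigU ((List.range (2 * n)).map ALC.atom)).size + 1 ≤ _
    rw [st.1]; simp; omega
  · change ∀ A ∈ (bigU ((List.range (2 * n)).map ALC.atom)).conceptNames, _
    rw [st.2.1]; simp; intro A hA; omega
  · change ∀ A ∈ insert 0 (bigU ((List.range (2 * n)).map ALC.atom)).roleNames, _
    rw [st.2.2]; simp
  obtain ⟨s1, s2, s3, s4⟩ := samp (fun i => e (g i)) T fun i => (hbox _).isExample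
  have hA := hAlg _ _ s1 s2 s3 ⟨T, hTl, s4⟩
  have hS := (h _ _ s1 s2 s3 ⟨T, hTl, s4⟩).2
  set P := posOf (fun i => e (g i)) T
  set N := negOf (fun i => e (g i)) T
  set H := Alg P N
  by_cases hp : ∀ y, (y, false) ∈ wrongSet e T H
  · exact count_aux2 _ (fun _ => false) hp
  push Not at hp
  obtain ⟨y0, hy0⟩ := hp
  rw [mem_wrongSet, not_not] at hy0
  have hH0 := fun hh => hTf y0 (hy0.2 hh)
  have hHf : ∀ x, (e (x, false)).2 ∉ H.sem (e (x, false)).1 := by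
    have : ∀ x, e (x, false) = e (y0, false) := by
      intro x
      simp only [e, Prod.mk.injEq, and_true, star, Interp.mk.injEq, true_and]
      funext A
      ext k
      simp only [KK, Set.mem_setOf_eq, Bool.false_eq_true, if_false, Set.mem_insert_iff,
        Set.mem_singleton_iff]
      constructor <;> rintro ⟨rfl | rfl, hh⟩ <;> simp [LA] at hh ⊢ <;> exact hh
    intro x; rw [this x]; exact hH0
  let S : Finset (Fin n → Bool) := Finset.univ.filter fun x => ∃ i, g i = (x, true)
  let G := bigU (S.toList.map fun x => DA n (XX x))
  have hGl : G.InLang O := by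
    refine bigU_lang h2 _ ?_
    simp only [List.mem_map]; rintro C ⟨i, -, rfl⟩; exact DA_lang h1 h2 _ _
  have hGs : ∀ (I : Interp) (a : ℕ),
      (a ∈ G.sem I ↔ ∃ x, (∃ i, g i = (x, true)) ∧ a ∈ (DA n (XX x)).sem I) := by
    intro I a
    rw [bigU_sem]
    simp [S]
  have hGH : Subsume G H := by
    intro I hI a ha
    rw [hGs I a] at ha
    obtain ⟨x, ⟨i, hi⟩, ha⟩ := ha
    by_contra hcon
    have h3 := claimA hn' hu n (XX x) (XX_lt x) H hA.1 (hHf x) fun hs => hcon (hs I hI ha)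
    exact h3 (hA.2.1 (e (x, true)) ⟨⟨i, by simp [hi]⟩, hTt x⟩)
  have hGf : Fits G P N := by
    constructor
    · rintro a ⟨⟨i, rfl⟩, hi⟩
      rcases hgi : g i with ⟨x, b⟩
      simp only [hgi] at hi ⊢
      cases b
      · exact absurd hi (hTf x)
      · exact (hGs _ _).2 ⟨x, ⟨i, hgi⟩, (DA_true hn x x).2 rfl⟩
    · intro a ha hh
      have hh2 := ha
      obtain ⟨⟨i, rfl⟩, hi⟩ := ha
      exact hA.2.2 _ hh2 (hGH _ (hbox _).1 hh)
  have hHG : Subsume H G := by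
    by_contra hcon
    exact hS ⟨G, hGl, hGf, hGH, fun hc => hcon hc.2⟩
  refine count_aux g hM _ fun y hy => ?_
  rw [mem_wrongSet]
  intro hiff
  have := hHG _ (hbox _).1 (hiff.1 (hTt y))
  obtain ⟨x, ⟨i, hi⟩, hx⟩ := (hGs _ _).1 this
  refine hy i ?_
  rw [hi]; exact ((DA_true hn y x).1 hx).symm

/-- Let O contain at least one of ∃/∀ and at least one of ⊓/⊔, and let
Alg be a fitting algorithm for L(O). Then Alg is not sample-efficient PAC if
(1) O ≠ {∃,⊔} and Alg always returns a most specific fitting; or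
(2) O ≠ {∀,⊓} and Alg always returns a most general fitting; or
(3) Alg always returns a fitting of minimal quantifier depth. -/
theorem statement11 (O : Set Op)
    (hq : Op.ex ∈ O ∨ Op.all ∈ O) (hc : Op.inter ∈ O ∨ Op.union ∈ O)
    (Alg : Set Ex → Set Ex → ALC) (hAlg : IsFittingAlg O Alg)
    (h : (O ≠ ({Op.ex, Op.union} : Set Op) ∧ ReturnsMostSpecific O Alg) ∨
         (O ≠ ({Op.all, Op.inter} : Set Op) ∧ ReturnsMostGeneral O Alg) ∨
         ReturnsMinQDepth O Alg) :
    ¬SampleEfficientPAC O Alg := by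
  rcases h with ⟨hne, h⟩ | ⟨hne, h⟩ | h
  · by_cases hi : Op.inter ∈ O
    · exact ms_easy O hq (fun C D hC hD => ⟨.inter C D, ⟨hi, hC, hD⟩, fun _ _ => rfl⟩) Alg hAlg h
    have hu := hc.resolve_left hi
    by_cases hn : Op.neg ∈ O
    · refine ms_easy O hq (fun C D hC hD => ⟨.neg (.union (.neg C) (.neg D)),
        ⟨hn, hu, ⟨hn, hC⟩, hn, hD⟩, fun I hI => ?_⟩) Alg hAlg h
      have h1 := sem_sub_dom C I hI
      have h2 := sem_sub_dom D I hI
      ext a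
      have h1 := @h1 a
      have h2 := @h2 a
      simp only [ALC.sem, Set.mem_diff, Set.mem_union, Set.mem_inter_iff]
      tauto
    by_cases ha : Op.all ∈ O
    · exact ms_hard O ha hu hn hi Alg hAlg h
    · have he := hq.resolve_right ha
      refine absurd ?_ hne
      ext o
      cases o <;> simp [hi, hu, hn, ha, he]
  · by_cases hu : Op.union ∈ O
    · exact mg_easy O hq (fun C D hC hD => ⟨.union C D, ⟨hu, hC, hD⟩, fun _ _ => rfl⟩) Alg hAlg h
    have hi := hc.resolve_right hu
    by_cases hn : Op.neg ∈ O
    · refine mg_easy O hq (fun C D hC hD => ⟨.neg (.inter (.neg C) (.neg D)),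
        ⟨hn, hi, ⟨hn, hC⟩, hn, hD⟩, fun I hI => ?_⟩) Alg hAlg h
      have h1 := sem_sub_dom C I hI
      have h2 := sem_sub_dom D I hI
      ext a
      have h1 := @h1 a
      have h2 := @h2 a
      simp only [ALC.sem, Set.mem_diff, Set.mem_union, Set.mem_inter_iff]
      tauto
    by_cases he : Op.ex ∈ O
    · exact mg_hard O he hi hn hu Alg hAlg h
    · have ha := hq.resolve_left he
      refine absurd ?_ hne
      ext o
      cases o <;> simp [hi, hu, hn, ha, he]
  · exact md_case O hq hc Alg h

end ALCPaper
end

section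
/- No fitting algorithm for L({∃,∀,⊓}) that always returns a most general fitting concept whenever a fitting exists is a sample-efficient PAC learning algorithm. -/
open scoped ENNReal

namespace ALCPaper

/-- Labels: all `A < 2n`. `L x A` says element `x` (≥ 2) carries label `A`. -/
def mkI (n : ℕ) (L : ℕ → ℕ → Prop) : Interp where
  dom := {x | x < n + 2}
  cI := fun A => {x | 2 ≤ x ∧ x < n + 2 ∧ A < 2 * n ∧ L x A}
  rI := fun r => {q | r = 0 ∧ q.1 < n + 2 ∧ 1 ≤ q.2 ∧ q.2 < n + 2 ∧ (1 ≤ q.1 → q.2 = 1)}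

open Classical in
noncomputable def lab {n : ℕ} (S : Finset (Fin n)) (i : Fin n) : ℕ :=
  2 * i.val + if i ∈ S then 1 else 0

lemma lab_lt {n : ℕ} (S : Finset (Fin n)) (i : Fin n) : lab S i < 2 * n := by
  unfold lab; have := i.2; split_ifs <;> omega

lemma lab_inj {n : ℕ} (S T : Finset (Fin n)) (i j : Fin n) (h : lab S i = lab T j) :
    i = j ∧ (i ∈ S ↔ i ∈ T) := by
  unfold lab at h
  have hij : i = j := by
    apply Fin.ext
    split_ifs at h <;> omega
  subst hij
  refine ⟨rfl, ?_⟩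
  by_cases h1 : i ∈ S <;> by_cases h2 : i ∈ T <;> simp [h1, h2] at h ⊢

def pI (n : ℕ) : Interp := mkI n (fun _ _ => True)

noncomputable def eI {n : ℕ} (S : Finset (Fin n)) : Interp :=
  mkI n (fun x A => ∀ i : Fin n, x = i.val + 2 → A ≠ lab S i)

lemma mem_bigI (l : List ALC) (I : Interp) (x : ℕ) :
    x ∈ (bigI l).sem I ↔ x ∈ I.dom ∧ ∀ c ∈ l, x ∈ c.sem I := by
  induction l with
  | nil => simp [bigI, ALC.sem]
  | cons c l ih =>
    simp only [bigI, ALC.sem, Set.mem_inter_iff, ih, List.mem_cons, forall_eq_or_imp]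
    tauto

lemma sem_dom (c : ALC) (I : Interp) (h : I.WF) : c.sem I ⊆ I.dom := by
  induction c with
  | bot => simp [ALC.sem]
  | top => simp [ALC.sem]
  | atom A => exact h.2.1 A
  | neg c ih => exact Set.diff_subset
  | inter c d ih1 ih2 => exact fun x hx => ih1 hx.1
  | union c d ih1 ih2 => exact fun x hx => hx.elim (fun h => ih1 h) (fun h => ih2 h)
  | all r c ih => exact fun x hx => hx.1
  | ex r c ih =>
    rintro x ⟨e, he, _⟩
    exact (h.2.2 r _ he).1

abbrev LO : Set Op := {Op.ex, Op.all, Op.inter}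

lemma bigI_inLang (l : List ALC) (h : ∀ c ∈ l, c.InLang LO) : (bigI l).InLang LO := by
  induction l with
  | nil => simp [bigI, ALC.InLang]
  | cons c l ih =>
    refine ⟨by simp, h c (by simp), ih fun d hd => h d (by simp [hd])⟩

lemma mkI_WF (n : ℕ) (L) : (mkI n L).WF := by
  refine ⟨⟨0, by simp [mkI]⟩, ?_, ?_⟩
  · rintro A x ⟨_, h, _⟩; exact h
  · rintro r q ⟨_, h1, _, h2, _⟩; exact ⟨h1, h2⟩

lemma mkI_example (n : ℕ) (L) : IsExample (mkI n L, 0) := by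
  refine ⟨mkI_WF n L, ⟨Set.finite_lt_nat _, ?_, ?_⟩, by simp [mkI]⟩
  · apply (Set.finite_lt_nat (2 * n)).subset
    rintro A ⟨x, _, _, h, _⟩; exact h
  · apply (Set.finite_singleton 0).subset
    rintro r ⟨x, h, _⟩; exact h

lemma mkI_size (n : ℕ) (L) : exSize (mkI n L, 0) ≤ 4 * (n + 2) ^ 2 := by
  unfold exSize Interp.numFacts
  have h1 : {p : ℕ × ℕ | p.2 ∈ (mkI n L).cI p.1}.ncard ≤ 2 * n * (n + 2) := by
    have : {p : ℕ × ℕ | p.2 ∈ (mkI n L).cI p.1} ⊆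
        ((Finset.range (2 * n) ×ˢ Finset.range (n + 2) : Finset (ℕ × ℕ)) : Set (ℕ × ℕ)) := by
      rintro ⟨A, x⟩ ⟨_, h1, h2, _⟩
      simp only [Finset.coe_product, Finset.coe_range, Set.mem_prod, Set.mem_Iio]
      exact ⟨h2, h1⟩
    have := Set.ncard_le_ncard this (Finset.finite_toSet _)
    rw [Set.ncard_coe_finset] at this
    simpa using this
  have h2 : {t : ℕ × ℕ × ℕ | (t.2.1, t.2.2) ∈ (mkI n L).rI t.1}.ncard ≤ (n + 2) * (n + 2) := by
    have : {t : ℕ × ℕ × ℕ | (t.2.1, t.2.2) ∈ (mkI n L).rI t.1} ⊆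
        ((Finset.range 1 ×ˢ (Finset.range (n + 2) ×ˢ Finset.range (n + 2)) :
          Finset (ℕ × ℕ × ℕ)) : Set (ℕ × ℕ × ℕ)) := by
      rintro ⟨r, x, y⟩ ⟨h0, h1, _, h2, _⟩
      simp only [Finset.coe_product, Finset.coe_range, Set.mem_prod, Set.mem_Iio]
      exact ⟨by simp at h0; omega, h1, h2⟩
    have := Set.ncard_le_ncard this (Finset.finite_toSet _)
    rw [Set.ncard_coe_finset] at this
    simpa using this
  show _ + _ + 1 ≤ _
  nlinarith

lemma bare (n : ℕ) (L L') (c : ALC) (hc : c.InLang LO) (h : 1 ∈ c.sem (mkI n L)) :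
    ∀ x, 1 ≤ x → x < n + 2 → x ∈ c.sem (mkI n L') := by
  induction c with
  | bot => exact h.elim
  | top => intro x _ h2; exact h2
  | atom A => have := h.1; omega
  | neg c ih => simp [ALC.InLang] at hc
  | union c d ih1 ih2 => simp [ALC.InLang] at hc
  | inter c d ih1 ih2 =>
    intro x h1 h2
    exact ⟨ih1 hc.2.1 h.1 x h1 h2, ih2 hc.2.2 h.2 x h1 h2⟩
  | all r c ih =>
    intro x h1 h2
    refine ⟨h2, ?_⟩
    rintro e ⟨hr, he1, he2, he3, he4⟩
    have he : e = 1 := he4 h1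
    subst he
    exact ih hc.2 (h.2 1 ⟨hr, by show 1 < n + 2; omega, le_refl _, by show 1 < n + 2; omega, fun _ => rfl⟩) 1
      (le_refl _) (by omega)
  | ex r c ih =>
    intro x h1 h2
    obtain ⟨e, ⟨hr, he1, he2, he3, he4⟩, hec⟩ := h
    have he : e = 1 := he4 (le_refl _)
    subst he
    exact ⟨1, ⟨hr, h2, le_refl _, by show 1 < n + 2; omega, fun _ => rfl⟩, ih hc.2 hec 1 (le_refl _) (by omega)⟩

lemma mid {n : ℕ} (S : Finset (Fin n)) (c : ALC) (hc : c.InLang LO) (y : ℕ) (hy : 2 ≤ y)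
    (h : y ∈ c.sem (pI n)) (i : Fin n) (h' : i.val + 2 ∉ c.sem (eI S)) :
    Subsume c (.atom (lab S i)) := by
  have hi := i.2
  induction c with
  | bot => exact h.elim
  | top => exact (h' (show i.val + 2 < n + 2 by omega)).elim
  | atom A =>
    obtain ⟨h1, h2, h3, -⟩ := h
    have : A = lab S i := by
      by_contra hne
      apply h'
      refine ⟨by omega, by omega, h3, ?_⟩
      intro j hj
      have : j = i := Fin.ext (by omega)
      subst this
      exact hne
    subst this
    exact fun I _ => le_refl _
  | neg c ih => simp [ALC.InLang] at hc
  | union c d ih1 ih2 => simp [ALC.InLang] at hc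
  | inter c d ih1 ih2 =>
    by_cases h1 : i.val + 2 ∈ c.sem (eI S)
    · have h2 : i.val + 2 ∉ d.sem (eI S) := fun h2 => h' ⟨h1, h2⟩
      intro I hI x hx
      exact ih2 hc.2.2 h.2 h2 I hI hx.2
    · intro I hI x hx
      exact ih1 hc.2.1 h.1 h1 I hI hx.1
  | all r c ih =>
    exfalso
    apply h'
    refine ⟨show i.val + 2 < n + 2 by omega, ?_⟩
    rintro e ⟨hr, he1, he2, he3, he4⟩
    refine bare n _ _ c hc.2 (h.2 1 ⟨hr, h.1, le_refl _, by show 1 < n + 2; omega, fun _ => rfl⟩) e he2 he3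
  | ex r c ih =>
    exfalso
    apply h'
    obtain ⟨e, ⟨hr, he1, he2, he3, he4⟩, hec⟩ := h
    have he : e = 1 := he4 (by show 1 ≤ y; omega)
    subst he
    exact ⟨1, ⟨hr, by show i.val + 2 < n + 2; omega, le_refl _, by show 1 < n + 2; omega, fun _ => rfl⟩,
      bare n _ _ c hc.2 hec 1 (le_refl _) (by omega)⟩

noncomputable def CS {n : ℕ} (S : Finset (Fin n)) : ALC :=
  .ex 0 (bigI ((List.finRange n).map fun i => .atom (lab S i)))

lemma root {n : ℕ} (S : Finset (Fin n)) (c : ALC) (hc : c.InLang LO)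
    (h : 0 ∈ c.sem (pI n)) (h' : 0 ∉ c.sem (eI S)) : Subsume c (CS S) := by
  induction c with
  | bot => exact h.elim
  | top => exact (h' (show 0 < n + 2 by omega)).elim
  | atom A => have := h.1; omega
  | neg c ih => simp [ALC.InLang] at hc
  | union c d ih1 ih2 => simp [ALC.InLang] at hc
  | inter c d ih1 ih2 =>
    by_cases h1 : 0 ∈ c.sem (eI S)
    · have h2 : 0 ∉ d.sem (eI S) := fun h2 => h' ⟨h1, h2⟩
      intro I hI x hx
      exact ih2 hc.2.2 h.2 h2 I hI hx.2
    · intro I hI x hx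
      exact ih1 hc.2.1 h.1 h1 I hI hx.1
  | all r c ih =>
    exfalso
    apply h'
    refine ⟨show 0 < n + 2 by omega, ?_⟩
    rintro e ⟨hr, he1, he2, he3, he4⟩
    refine bare n _ _ c hc.2 (h.2 1 ⟨hr, h.1, le_refl _, by show 1 < n + 2; omega, fun _ => rfl⟩) e he2 he3
  | ex r c ih =>
    obtain ⟨e, ⟨hr, he1, he2, he3, he4⟩, hec⟩ := h
    simp only at he1 he2 he3 he4
    subst hr
    by_cases he : e = 1
    · subst he
      exfalso
      apply h'
      exact ⟨1, ⟨rfl, by show 0 < n + 2; omega, le_refl _, by show 1 < n + 2; omega, fun _ => rfl⟩,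
        bare n _ _ c hc.2 hec 1 (le_refl _) (by omega)⟩
    · have key : ∀ i : Fin n, Subsume c (.atom (lab S i)) := by
        intro i
        have := i.2
        refine mid S c hc.2 e (by omega) hec i ?_
        intro hh
        exact h' ⟨i.val + 2, ⟨rfl, by show 0 < n + 2; omega, by show 1 ≤ i.val + 2; omega,
          by show i.val + 2 < n + 2; omega, by intro h; simp at h⟩, hh⟩
      rintro I hI x ⟨y, hy, hyc⟩
      refine ⟨y, hy, ?_⟩
      rw [mem_bigI]
      refine ⟨sem_dom _ _ hI hyc, ?_⟩
      intro d hd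
      obtain ⟨i, -, rfl⟩ := List.mem_map.1 hd
      exact key i I hI hyc

def CTn (n : ℕ) : ALC := .ex 0 (bigI ((List.range (2 * n)).map fun A => .atom A))

lemma p_CS {n : ℕ} (hn : 0 < n) (S : Finset (Fin n)) : 0 ∈ (CS S).sem (pI n) := by
  refine ⟨2, ⟨rfl, by show 0 < n + 2; omega, by show 1 ≤ 2; omega, by show 2 < n + 2; omega,
    by intro h; simp at h⟩, ?_⟩
  rw [mem_bigI]
  refine ⟨show 2 < n + 2 by omega, ?_⟩
  intro d hd
  obtain ⟨i, -, rfl⟩ := List.mem_map.1 hd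
  exact ⟨le_refl _, by omega, lab_lt S i, trivial⟩

lemma p_CT {n : ℕ} (hn : 0 < n) : 0 ∈ (CTn n).sem (pI n) := by
  refine ⟨2, ⟨rfl, by show 0 < n + 2; omega, by show 1 ≤ 2; omega, by show 2 < n + 2; omega,
    by intro h; simp at h⟩, ?_⟩
  rw [mem_bigI]
  refine ⟨show 2 < n + 2 by omega, ?_⟩
  intro d hd
  obtain ⟨i, hi, rfl⟩ := List.mem_map.1 hd
  exact ⟨le_refl _, by omega, List.mem_range.1 hi, trivial⟩

lemma e_CS_self {n : ℕ} (hn : 0 < n) (S : Finset (Fin n)) : 0 ∉ (CS S).sem (eI S) := by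
  rintro ⟨y, ⟨-, -, h1, h2, -⟩, hy⟩
  rw [mem_bigI] at hy
  have hy := hy.2
  simp only [List.forall_mem_map] at hy
  have h3 := (hy ⟨0, hn⟩ (List.mem_finRange _)).1
  simp only at h1 h2
  obtain ⟨_, _, _, h4⟩ := hy ⟨y - 2, by omega⟩ (List.mem_finRange _)
  exact h4 ⟨y - 2, by omega⟩ (by simp; omega) rfl

lemma e_CS_ne {n : ℕ} (S T : Finset (Fin n)) (h : S ≠ T) : 0 ∈ (CS S).sem (eI T) := by
  have : ∃ i, ¬ (i ∈ S ↔ i ∈ T) := by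
    by_contra hh
    push Not at hh
    exact h (Finset.ext hh)
  obtain ⟨i, hi⟩ := this
  have hi2 := i.2
  refine ⟨i.val + 2, ⟨rfl, by show 0 < n + 2; omega, by show 1 ≤ i.val + 2; omega,
    by show i.val + 2 < n + 2; omega, by intro h; simp at h⟩, ?_⟩
  rw [mem_bigI]
  refine ⟨show i.val + 2 < n + 2 by omega, ?_⟩
  intro d hd
  obtain ⟨j, -, rfl⟩ := List.mem_map.1 hd
  refine ⟨by omega, by omega, lab_lt S j, ?_⟩
  intro k hk hlab
  have : k = i := Fin.ext (by omega)
  subst this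
  obtain ⟨h1, h2⟩ := lab_inj _ _ _ _ hlab
  subst h1
  exact hi h2

lemma e_CT {n : ℕ} (hn : 0 < n) (S : Finset (Fin n)) : 0 ∉ (CTn n).sem (eI S) := by
  rintro ⟨y, ⟨hr, h0, h1, h2, h3⟩, hy⟩
  apply e_CS_self hn S
  refine ⟨y, ⟨hr, h0, h1, h2, h3⟩, ?_⟩
  rw [mem_bigI] at hy ⊢
  refine ⟨hy.1, ?_⟩
  intro d hd
  obtain ⟨j, -, rfl⟩ := List.mem_map.1 hd
  exact hy.2 _ (List.mem_map.2 ⟨lab S j, List.mem_range.2 (lab_lt S j), rfl⟩)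

lemma CS_inLang {n : ℕ} (S : Finset (Fin n)) : (CS S).InLang LO := by
  refine ⟨by simp, bigI_inLang _ ?_⟩
  intro d hd
  obtain ⟨j, -, rfl⟩ := List.mem_map.1 hd
  trivial

lemma CT_inLang (n : ℕ) : (CTn n).InLang LO := by
  refine ⟨by simp, bigI_inLang _ ?_⟩
  intro d hd
  obtain ⟨j, -, rfl⟩ := List.mem_map.1 hd
  trivial

lemma eI_inj {n : ℕ} (hn : 0 < n) (S T : Finset (Fin n)) (h : eI S = eI T) : S = T := by
  by_contra hne
  have := e_CS_ne S T hne
  rw [← h] at this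
  exact e_CS_self hn S this

lemma size_big (l : List ℕ) : (bigI (l.map fun A => .atom A)).size = 2 * l.length + 1 := by
  induction l with
  | nil => simp [bigI, ALC.size]
  | cons a l ih => simp only [List.map_cons, bigI, ALC.size, ih, List.length_cons]; omega

lemma roles_big (l : List ℕ) : (bigI (l.map fun A => .atom A)).roleNames = ∅ := by
  induction l with
  | nil => simp [bigI, ALC.roleNames]
  | cons a l ih => simp [bigI, ALC.roleNames, ih]

lemma names_big (l : List ℕ) : (bigI (l.map fun A => .atom A)).conceptNames = l.toFinset := by
  induction l with
  | nil => simp [bigI, ALC.conceptNames]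
  | cons a l ih => simp [bigI, ALC.conceptNames, ih]

noncomputable def gg (n : ℕ) (a : Bool × Finset (Fin n)) : Ex :=
  if a.1 then (pI n, 0) else (eI a.2, 0)

noncomputable def DD (n : ℕ) : PMF Ex := (PMF.uniformOfFintype (Bool × Finset (Fin n))).map (gg n)

lemma DD_supp (n : ℕ) (e : Ex) (h : DD n e ≠ 0) : ∃ a, gg n a = e := by
  have : e ∈ (DD n).support := h
  rw [DD, PMF.support_map] at this
  obtain ⟨a, _, ha⟩ := this
  exact ⟨a, ha⟩

lemma gg_ex (n : ℕ) (a) : ∃ L, gg n a = (mkI n L, 0) := by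
  unfold gg; split_ifs
  · exact ⟨_, rfl⟩
  · exact ⟨_, rfl⟩

lemma DD_sig (n : ℕ) : DistOverSig (DD n) {A | A < 2 * n} {0} (4 * (n + 2) ^ 2) := by
  intro e he
  obtain ⟨a, rfl⟩ := DD_supp n e he
  obtain ⟨L, hL⟩ := gg_ex n a
  rw [hL]
  refine ⟨mkI_example n L, mkI_size n L, ?_, ?_⟩
  · rintro A ⟨x, _, _, h, _⟩; exact h
  · rintro r ⟨x, h, _⟩; exact h

lemma err_big (n : ℕ) (X : Set Ex) (Y : Finset (Bool × Finset (Fin n)))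
    (hY : ∀ a ∈ Y, gg n a ∈ X) (hc : 2 ^ n < 2 * Y.card) :
    ENNReal.ofReal (1 / 4) < probOf (DD n) X := by
  classical
  have h1 : probOf (DD n) X = (DD n).toOuterMeasure X := (PMF.toOuterMeasure_apply _ _).symm
  rw [h1, DD, PMF.toOuterMeasure_map_apply]
  have h2 : (PMF.uniformOfFintype (Bool × Finset (Fin n))).toOuterMeasure (Y : Set _) ≤
      (PMF.uniformOfFintype (Bool × Finset (Fin n))).toOuterMeasure (gg n ⁻¹' X) :=
    MeasureTheory.measure_mono (fun a ha => hY a ha)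
  refine lt_of_lt_of_le ?_ h2
  rw [PMF.toOuterMeasure_uniformOfFintype_apply]
  simp only [Fintype.card_prod, Fintype.card_bool, Fintype.card_finset, Fintype.card_fin,
    Fintype.card_coe, Finset.coe_sort_coe]
  rw [show ((Y.card : ℝ≥0∞)) = ENNReal.ofReal (Y.card : ℝ) by simp,
    show (((2 * 2 ^ n : ℕ)) : ℝ≥0∞) = ENNReal.ofReal ((2 * 2 ^ n : ℕ) : ℝ) from
      (ENNReal.ofReal_natCast _).symm,
    ← ENNReal.ofReal_div_of_pos (by positivity)]
  have hc' : (2 : ℝ) ^ n < 2 * (Y.card : ℝ) := by exact_mod_cast hc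
  have hp : (0 : ℝ) < 2 ^ n := by positivity
  rw [ENNReal.ofReal_lt_ofReal_iff_of_nonneg (by norm_num)]
  push_cast
  rw [div_lt_div_iff₀ (by norm_num) (by positivity)]
  linarith

lemma fail_all (Alg : Set Ex → Set Ex → ALC)
    (hAlg : IsFittingAlg LO Alg) (hmg : ReturnsMostGeneral LO Alg)
    {n : ℕ} (hn : 0 < n) {M : ℕ} (hM : 2 * M < 2 ^ n) (f : Fin M → Ex)
    (hf : ∀ i, ∃ a, gg n a = f i) :
    ENNReal.ofReal (1 / 4) <
      errP (DD n) (CTn n) (Alg (posOf f (CTn n)) (negOf f (CTn n))) := by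
  classical
  have hPf : (posOf f (CTn n)).Finite :=
    (Set.finite_range f).subset fun e he => he.1
  have hNf : (negOf f (CTn n)).Finite :=
    (Set.finite_range f).subset fun e he => he.1
  have hE : ∀ e ∈ posOf f (CTn n) ∪ negOf f (CTn n), IsExample e := by
    intro e he
    have : ∃ i, f i = e := by
      rcases he with he | he
      · exact he.1
      · exact he.1
    obtain ⟨i, rfl⟩ := this
    obtain ⟨a, ha⟩ := hf i
    obtain ⟨L, hL⟩ := gg_ex n a
    rw [← ha, hL]
    exact mkI_example n L
  have hfit : ∃ C : ALC, C.InLang LO ∧ Fits C (posOf f (CTn n)) (negOf f (CTn n)) :=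
    ⟨CTn n, CT_inLang n, fun e he => he.2, fun e he => he.2⟩
  obtain ⟨hlang, -⟩ := hAlg _ _ hPf hNf hE hfit
  obtain ⟨hfits, hmost⟩ := hmg _ _ hPf hNf hE hfit
  generalize hH : Alg (posOf f (CTn n)) (negOf f (CTn n)) = H at *
  by_cases hp : 0 ∈ H.sem (pI n)
  · -- most general
    let T : Finset (Finset (Fin n)) := Finset.univ.filter fun S => ∃ i, f i = (eI S, 0)
    have hT : T.card ≤ M := by
      have hch : ∀ S ∈ T, ∃ i, f i = (eI S, 0) := fun S hS => (Finset.mem_filter.1 hS).2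
      choose k hk using hch
      calc T.card = (T.attach).card := by simp
        _ ≤ (Finset.univ : Finset (Fin M)).card := by
          apply Finset.card_le_card_of_injOn (fun S => k S.1 S.2) (fun _ _ => by simp)
          rintro ⟨S, hS⟩ - ⟨S', hS'⟩ - hh
          have h1 := hk S hS
          have h2 := hk S' hS'
          simp only at hh
          rw [hh, h2] at h1
          exact Subtype.ext (eI_inj hn _ _ (Prod.ext_iff.1 h1).1.symm)
        _ = M := by simp
    let G := bigI (T.toList.map CS)
    have hG1 : G.InLang LO := by
      apply bigI_inLang
      intro d hd
      obtain ⟨S, -, rfl⟩ := List.mem_map.1 hd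
      exact CS_inLang S
    have hG2 : Fits G (posOf f (CTn n)) (negOf f (CTn n)) := by
      constructor
      · rintro e ⟨⟨i, rfl⟩, he⟩
        obtain ⟨⟨b, S⟩, ha⟩ := hf i
        rw [← ha] at he ⊢
        cases b with
        | false => exact (e_CT hn S he).elim
        | true =>
          show 0 ∈ G.sem (pI n)
          rw [mem_bigI]
          refine ⟨show 0 < n + 2 by omega, ?_⟩
          intro d hd
          obtain ⟨S, -, rfl⟩ := List.mem_map.1 hd
          exact p_CS hn S
      · rintro e ⟨⟨i, rfl⟩, he⟩
        obtain ⟨⟨b, S⟩, ha⟩ := hf i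
        cases b with
        | true => rw [← ha] at he; exact (he (p_CT hn)).elim
        | false =>
          have ha' : f i = (eI S, 0) := ha.symm
          rw [ha']
          intro hh
          have hh := ((mem_bigI _ _ _).1 hh).2 (CS S) (List.mem_map.2 ⟨S, by
            simp only [Finset.mem_toList, T, Finset.mem_filter, Finset.mem_univ, true_and]
            exact ⟨i, ha'⟩, rfl⟩)
          exact e_CS_self hn S hh
    have hG3 : Subsume H G := by
      intro I hI x hx
      rw [mem_bigI]
      refine ⟨sem_dom _ _ hI hx, ?_⟩
      intro d hd
      obtain ⟨S, hS, rfl⟩ := List.mem_map.1 hd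
      obtain ⟨i, hi⟩ : ∃ i, f i = (eI S, 0) := by simpa [T] using hS
      refine root S H hlang hp ?_ I hI hx
      exact hfits.2 (eI S, 0) ⟨⟨i, hi⟩, e_CT hn S⟩
    have hG4 : Subsume G H := by
      by_contra hh
      exact hmost ⟨G, hG1, hG2, hG3, fun h => hh h.2⟩
    refine err_big n _ (Tᶜ.map ⟨fun S => (false, S), fun a b h => (Prod.ext_iff.1 h).2⟩) ?_ ?_
    · intro a ha
      obtain ⟨S, hS, rfl⟩ := Finset.mem_map.1 ha
      have hS' : S ∉ T := Finset.mem_compl.1 hS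
      right
      refine ⟨?_, e_CT hn S⟩
      show 0 ∈ H.sem (eI S)
      apply hG4 _ (mkI_WF n _)
      show 0 ∈ G.sem (eI S)
      rw [mem_bigI]
      refine ⟨show 0 < n + 2 by omega, ?_⟩
      intro d hd
      obtain ⟨S', hS2, rfl⟩ := List.mem_map.1 hd
      apply e_CS_ne
      rintro rfl
      exact hS' (Finset.mem_toList.1 hS2)
    · rw [Finset.card_map, Finset.card_compl, Fintype.card_finset, Fintype.card_fin]
      omega
  · refine err_big n _ (Finset.univ.map ⟨fun S => (true, S), fun a b h => (Prod.ext_iff.1 h).2⟩) ?_ ?_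
    · intro a ha
      obtain ⟨S, hS, rfl⟩ := Finset.mem_map.1 ha
      left
      exact ⟨p_CT hn, hp⟩
    · rw [Finset.card_map, Finset.card_univ, Fintype.card_finset, Fintype.card_fin]
      have : 0 < 2 ^ n := by positivity
      omega

lemma growth (c d : ℕ) : ∃ n : ℕ, 0 < n ∧ 2 * (c * (10 * (n + 2) ^ 2) ^ d) < 2 ^ n := by
  have h := tendsto_pow_const_div_const_pow_of_one_lt (2 * d) (r := (2 : ℝ)) (by norm_num)
  have hpos : (0 : ℝ) < 1 / (8 * c * 10 ^ d + 1) := by positivity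
  have h2 := (h.eventually_lt_const hpos).and (Filter.eventually_ge_atTop 3)
  obtain ⟨K, hK, hK3⟩ := h2.exists
  obtain ⟨n, rfl⟩ : ∃ n, K = n + 2 := ⟨K - 2, by omega⟩
  refine ⟨n, by omega, ?_⟩
  rw [div_lt_div_iff₀ (by positivity) (by positivity)] at hK
  have hx : (((n + 2 : ℕ) : ℝ)) ^ (2 * d) * (8 * c * 10 ^ d + 1) < 1 * 2 ^ (n + 2) := hK
  have hx' : (n + 2) ^ (2 * d) * (8 * c * 10 ^ d + 1) < 1 * 2 ^ (n + 2) := by exact_mod_cast hx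
  have e1 : (10 * (n + 2) ^ 2) ^ d = 10 ^ d * (n + 2) ^ (2 * d) := by
    rw [mul_pow, ← pow_mul]
  rw [e1]
  rw [pow_add 2 n 2] at hx'
  have : 0 ≤ (n + 2) ^ (2 * d) := by positivity
  nlinarith

/-- No fitting algorithm for L({∃,∀,⊓}) that always returns a most
general fitting concept whenever a fitting exists is a sample-efficient PAC
learning algorithm. -/
theorem statement14 (Alg : Set Ex → Set Ex → ALC)
    (hAlg : IsFittingAlg {Op.ex, Op.all, Op.inter} Alg)
    (hmg : ReturnsMostGeneral {Op.ex, Op.all, Op.inter} Alg) :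
    ¬SampleEfficientPAC {Op.ex, Op.all, Op.inter} Alg := by
  rintro ⟨m, ⟨c, d, hm⟩, hpac⟩
  obtain ⟨n, hn, hgr⟩ := growth c d
  have h := hpac (1 / 4) (1 / 2) (by norm_num) (by norm_num) (by norm_num) (by norm_num)
    {A | A < 2 * n} {0} (Set.finite_lt_nat _) (Set.finite_singleton 0) (4 * (n + 2) ^ 2) (4 * n + 2)
    (DD n) (DD_sig n) (CTn n) (CT_inLang n)
    (by intro A; simp [CTn, ALC.conceptNames, names_big])
    (by intro A; simp [CTn, ALC.roleNames, roles_big])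
    (by simp only [CTn, ALC.size, size_big, List.length_range]; omega)
  have hs : ({A : ℕ | A < 2 * n}).ncard = 2 * n := by
    have : {A : ℕ | A < 2 * n} = ((Finset.range (2 * n) : Finset ℕ) : Set ℕ) := by ext; simp
    rw [this, Set.ncard_coe_finset, Finset.card_range]
  have hb := hm (1 / (1 / 2)) (1 / (1 / 4)) (({A : ℕ | A < 2 * n}).ncard + ({0} : Set ℕ).ncard)
    (4 * (n + 2) ^ 2) (4 * n + 2)
  generalize m (1 / (1 / 2)) (1 / (1 / 4)) (({A : ℕ | A < 2 * n}).ncard + ({0} : Set ℕ).ncard)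
    (4 * (n + 2) ^ 2) (4 * n + 2) = M at h hb
  rw [hs, Set.ncard_singleton] at hb
  have e2 : ⌈|(1 / (1 / 2) : ℝ)|⌉₊ = 2 := by
    rw [show |(1 / (1 / 2) : ℝ)| = ((2 : ℕ) : ℝ) by norm_num, Nat.ceil_natCast]
  have e4 : ⌈|(1 / (1 / 4) : ℝ)|⌉₊ = 4 := by
    rw [show |(1 / (1 / 4) : ℝ)| = ((4 : ℕ) : ℝ) by norm_num, Nat.ceil_natCast]
  rw [e2, e4] at hb
  have hle : 2 + 4 + (2 * n + 1) + 4 * (n + 2) ^ 2 + (4 * n + 2) + 1 ≤ 10 * (n + 2) ^ 2 := by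
    nlinarith
  have hb2 : M ≤ c * (10 * (n + 2) ^ 2) ^ d :=
    hb.trans (Nat.mul_le_mul_left c (Nat.pow_le_pow_left hle d))
  have hM : 2 * M < 2 ^ n := by omega
  have hz : iidProb (DD n) M {f | (Alg (posOf f (CTn n)) (negOf f (CTn n))).InLang
      {Op.ex, Op.all, Op.inter} ∧
      errP (DD n) (CTn n) (Alg (posOf f (CTn n)) (negOf f (CTn n))) ≤ ENNReal.ofReal (1 / 4)} = 0 := by
    unfold iidProb
    rw [ENNReal.tsum_eq_zero]
    intro f
    by_cases hf : ∀ i, ∃ a, gg n a = f i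
    · rw [Set.indicator_of_notMem]
      rintro ⟨-, h2⟩
      exact absurd (fail_all Alg hAlg hmg hn hM f hf) (not_lt.2 h2)
    · push Not at hf
      obtain ⟨i, hi⟩ := hf
      apply Set.indicator_apply_eq_zero.2
      intro _
      apply Finset.prod_eq_zero (Finset.mem_univ i)
      by_contra h0
      obtain ⟨a, ha⟩ := DD_supp n _ h0
      exact hi a ha
  rw [hz] at h
  have h1 : ENNReal.ofReal (1 / 2) < 1 := by
    rw [ENNReal.ofReal_lt_one]; norm_num
  have := tsub_pos_of_lt h1
  exact absurd h (not_le.2 this)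

end ALCPaper
end
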